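/- arXiv:1602.02609 — 2 statements merged into one kernel-verified Lean document; each statement's English description precedes it below -/
import Mathlib

section
/- Let X be a non-empty separable metric space and let n be a positive integer. Then d^n_H(X × [0,1]ⁿ) = dim_H X, where X × [0,1]ⁿ carries the ℓ² product metric. -/
open Set Metric Filter Topology TopologicalSpace
open scoped ENNReal NNReal

noncomputable section

universe u

/-- `indBelow n X` means that the small inductive (topological) dimension of `X`
is at most `n - 1`; in particular `indBelow 0 X` means `X = ∅`. -/
def indBelow : ℕ → ∀ (X : Type u) [TopologicalSpace X], Prop
  | 0, X, _ => IsEmpty X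
  | n + 1, X, inst =>
      letI := inst
      ∀ (x : X) (U : Set X), IsOpen U → x ∈ U →
        ∃ V : Set X, IsOpen V ∧ x ∈ V ∧ V ⊆ U ∧ indBelow n ↥(frontier V)

/-- The small inductive (topological) dimension, with values in `EReal`:
`-1` for the empty space and `⊤` if there is no finite bound. -/
def indDim (X : Type u) [TopologicalSpace X] : EReal :=
  sInf {d : EReal | ∃ n : ℕ, indBelow n X ∧ d = (n : EReal) - 1}

variable {X : Type u} [MetricSpace X]

/-- Topological dimension of a subset of a metric space. -/
def tdim (A : Set X) : EReal := indDim ↥A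

open Classical in
/-- Hausdorff dimension of a subset of a metric space,
with the convention `dim ∅ = -1`. -/
def hdim (A : Set X) : EReal := if A = ∅ then -1 else ((dimH A : ℝ≥0∞) : EReal)

/-- A `δ`-packing of `A`: a countable family of pairwise disjoint closed balls
with centers in `A` and radii at most `δ`. -/
def IsPacking (A : Set X) (δ : ℝ≥0) (s : Set (X × ℝ≥0)) : Prop :=
  s.Countable ∧ (∀ p ∈ s, p.1 ∈ A ∧ p.2 ≤ δ) ∧
    s.Pairwise fun p q => Disjoint (closedBall p.1 (p.2 : ℝ)) (closedBall q.1 (q.2 : ℝ))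

/-- The packing pre-measure `P^h_δ(A)`. -/
def packPre (h : ℝ≥0 → ℝ≥0) (A : Set X) (δ : ℝ≥0) : ℝ≥0∞ :=
  ⨆ (s : Set (X × ℝ≥0)) (_ : IsPacking A δ s), ∑' p : s, ((h p.1.2 : ℝ≥0) : ℝ≥0∞)

/-- The packing pre-measure (packing number) `P^h₀(A) = lim_{δ → 0+} P^h_δ(A)`. -/
def packPre0 (h : ℝ≥0 → ℝ≥0) (A : Set X) : ℝ≥0∞ :=
  ⨅ (δ : ℝ≥0) (_ : 0 < δ), packPre h A δ

/-- The `h`-packing measure `𝒫^h(A)`. -/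
def packMeasure (h : ℝ≥0 → ℝ≥0) (A : Set X) : ℝ≥0∞ :=
  ⨅ (c : ℕ → Set X) (_ : A = ⋃ i, c i), ∑' i, packPre0 h (c i)

open Classical in
/-- The packing dimension, with the convention `dim ∅ = -1`. -/
def pdim (A : Set X) : EReal :=
  if A = ∅ then -1
  else max 0 (⨆ (s : ℝ≥0) (_ : packMeasure (fun r => r ^ (s : ℝ)) A = ∞), ((s : ℝ) : EReal))

/-- The restriction of the packing measure `𝒫^h` to `A` is σ-finite. -/
def PackSigmaFiniteOn (h : ℝ≥0 → ℝ≥0) (A : Set X) : Prop :=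
  ∃ c : ℕ → Set X, A ⊆ ⋃ i, c i ∧ ∀ i, packMeasure h (A ∩ c i) < ∞

/-- The generalized Hausdorff measure `ℋ^h(A)` associated to a gauge function `h`. -/
def hMeasure (h : ℝ≥0 → ℝ≥0) (A : Set X) : ℝ≥0∞ :=
  ⨆ (δ : ℝ≥0) (_ : 0 < δ),
    ⨅ (c : ℕ → Set X) (_ : A ⊆ ⋃ i, c i) (_ : ∀ i, EMetric.diam (c i) ≤ (δ : ℝ≥0∞)),
      ∑' i, ((h (EMetric.diam (c i)).toNNReal : ℝ≥0) : ℝ≥0∞)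

/-- `F` is an `F_σ` subset of the subspace `A`. -/
def IsFSigmaIn (F A : Set X) : Prop :=
  ∃ C : ℕ → Set X, (∀ i, IsClosed (C i)) ∧ F = ⋃ i, C i ∩ A

/-- `d^n_*(A) = inf {dim_*(A ∖ F) : F ⊆ A is F_σ in A and dim_T F ≤ n - 1}`. -/
def dStar (dim : Set X → EReal) (n : ℕ) (A : Set X) : EReal :=
  sInf {d : EReal |
    ∃ F : Set X, IsFSigmaIn F A ∧ tdim F ≤ (n : EReal) - 1 ∧ d = dim (A \ F)}

end

/-- The cubical cup product of the coboundaries of the mod 2 cochains `u a`, `a ∈ l`, evaluated on the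
lattice cube with base vertex `v` and edge directions `S`. -/
def cubeCup {ι : Type*} [DecidableEq ι] (u : ι → (ι → ℕ) → ZMod 2) :
    List ι → Finset ι → (ι → ℕ) → ZMod 2
  | [], _, _ => 1
  | a :: l, S, v => ∑ j ∈ S, (u a (v + Pi.single j 1) + u a v) *
      cubeCup u l (S.erase j) (v + Pi.single j 1)

section CubeCup

variable {ι : Type*} [DecidableEq ι] (u : ι → (ι → ℕ) → ZMod 2)

theorem zmod_two_add_self (a : ZMod 2) : a + a = 0 := CharTwo.add_self_eq_zero a

/-- A double sum of a symmetric function over ordered pairs of distinct elements vanishes mod 2. -/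
theorem sum_erase_symm_eq_zero (S : Finset ι) (f : ι → ι → ZMod 2) (hf : ∀ i j, f i j = f j i) :
    ∑ i ∈ S, ∑ j ∈ S.erase i, f i j = 0 := by
  induction S using Finset.induction_on with
  | empty => simp
  | insert a S ha ih =>
    rw [Finset.sum_insert ha, Finset.erase_insert ha]
    have : ∀ i ∈ S, ∑ j ∈ (insert a S).erase i, f i j = f i a + ∑ j ∈ S.erase i, f i j := by
      intro i hi
      have hne : a ≠ i := fun h => ha (h ▸ hi)
      rw [Finset.erase_insert_of_ne hne, Finset.sum_insert (by simp [ha])]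
    rw [Finset.sum_congr rfl this, Finset.sum_add_distrib, ih, add_zero,
      Finset.sum_congr rfl fun i _ => hf a i]
    exact zmod_two_add_self _

theorem cubeCup_closed (l : List ι) : ∀ (S : Finset ι) (v : ι → ℕ),
    ∑ j ∈ S, (cubeCup u l (S.erase j) (v + Pi.single j 1) + cubeCup u l (S.erase j) v) = 0 := by
  induction l with
  | nil =>
    intro S v
    simp only [cubeCup]
    exact Finset.sum_eq_zero fun _ _ => zmod_two_add_self _
  | cons a l ih =>
    intro S v
    simp only [cubeCup]
    set P : ι → ι → (ι → ℕ) → ZMod 2 := fun i j w => cubeCup u l ((S.erase i).erase j) w with hP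
    have hPs : ∀ i j w, P i j w = P j i w := fun i j w => by
      simp only [hP, Finset.erase_right_comm]
    have key : ∀ i ∈ S, (∑ j ∈ S.erase i, (u a (v + Pi.single i 1 + Pi.single j 1) + u a (v + Pi.single i 1)) *
          P i j (v + Pi.single i 1 + Pi.single j 1) +
        ∑ j ∈ S.erase i, (u a (v + Pi.single j 1) + u a v) * P i j (v + Pi.single j 1)) =
        ∑ j ∈ S.erase i, (u a (v + Pi.single i 1 + Pi.single j 1) + u a (v + Pi.single i 1)
            + u a (v + Pi.single j 1) + u a v) * P i j (v + Pi.single i 1 + Pi.single j 1) +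
        ∑ j ∈ S.erase i, (u a (v + Pi.single j 1) + u a v) *
          (P i j (v + Pi.single j 1 + Pi.single i 1) + P i j (v + Pi.single j 1)) := by
      intro i _
      rw [← Finset.sum_add_distrib, ← Finset.sum_add_distrib]
      refine Finset.sum_congr rfl fun j _ => ?_
      rw [add_right_comm v (Pi.single j 1) (Pi.single i 1)]
      linear_combination -zmod_two_add_self ((u a (v + Pi.single j 1) + u a v) *
        P i j (v + Pi.single i 1 + Pi.single j 1))
    rw [Finset.sum_congr rfl key, Finset.sum_add_distrib]
    have hsymm := sum_erase_symm_eq_zero S (fun i j => (u a (v + Pi.single i 1 + Pi.single j 1)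
      + u a (v + Pi.single i 1) + u a (v + Pi.single j 1) + u a v) *
        P i j (v + Pi.single i 1 + Pi.single j 1)) fun i j => by
      rw [hPs i j, add_right_comm v (Pi.single j 1) (Pi.single i 1)]
      ring
    beta_reduce at hsymm
    rw [hsymm, zero_add, Finset.sum_comm' (t' := S) (s' := fun j => S.erase j)]
    · refine Finset.sum_eq_zero fun j _ => ?_
      rw [← Finset.mul_sum]
      have := ih (S.erase j) (v + Pi.single j 1)
      rw [Finset.sum_congr rfl fun i _ => by rw [hPs i j, hPs i j], this, mul_zero]
    · intro x y; simp only [Finset.mem_erase]; tauto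

theorem cubeCup_eq_zero {l : List ι} {a : ι} (ha : a ∈ l) : ∀ (S : Finset ι) (v : ι → ℕ),
    (∀ w w' : ι → ℕ, (∀ i, v i ≤ w i ∧ w i ≤ v i + if i ∈ S then 1 else 0) →
      (∀ i, v i ≤ w' i ∧ w' i ≤ v i + if i ∈ S then 1 else 0) → u a w = u a w') →
    cubeCup u l S v = 0 := by
  induction l with
  | nil => simp at ha
  | cons b l ih =>
    intro S v h
    simp only [cubeCup]
    refine Finset.sum_eq_zero fun j hj => ?_
    rcases List.mem_cons.1 ha with rfl | hal
    · rw [h (v + Pi.single j 1) v, zmod_two_add_self, zero_mul]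
      · intro i
        by_cases hij : i = j
        · subst hij; simp [hj]
        · simp [hij]
      · intro i; simp
    · rw [ih hal, mul_zero]
      intro w w' hw hw'
      refine h w w' ?_ ?_ <;> intro i
      · have := hw i
        by_cases hij : i = j
        · subst hij; simp [hj] at this ⊢; omega
        · simpa [hij] using this
      · have := hw' i
        by_cases hij : i = j
        · subst hij; simp [hj] at this ⊢; omega
        · simpa [hij] using this

variable [Fintype ι]

/-- Base vertices of the lattice cubes with directions `S` in the face of `[0, N]^ι` on which all
coordinates outside `S` equal `N`. -/
def gridFace (N : ℕ) (S : Finset ι) : Finset (ι → ℕ) :=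
  Fintype.piFinset fun i => if i ∈ S then Finset.range N else {N}

theorem mem_gridFace {N : ℕ} {S : Finset ι} {v : ι → ℕ} :
    v ∈ gridFace N S ↔ (∀ i ∈ S, v i < N) ∧ ∀ i ∉ S, v i = N := by
  simp only [gridFace, Fintype.mem_piFinset]
  constructor
  · intro h
    exact ⟨fun i hi => by simpa [hi] using h i, fun i hi => by simpa [hi] using h i⟩
  · rintro ⟨h1, h2⟩ i
    by_cases hi : i ∈ S
    · simpa [hi] using h1 i hi
    · simpa [hi] using h2 i hi

theorem sum_gridFace (N : ℕ) {S : Finset ι} {j : ι} (hj : j ∈ S) (f : (ι → ℕ) → ZMod 2) :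
    ∑ v ∈ gridFace N S, f v =
      ∑ v ∈ gridFace N (S.erase j), ∑ x ∈ Finset.range N, f (Function.update v j x) := by
  rw [← Finset.sum_product']
  refine Finset.sum_nbij' (fun v => (Function.update v j N, v j))
    (fun p => Function.update p.1 j p.2) ?_ ?_ ?_ ?_ ?_
  · intro v hv
    rw [mem_gridFace] at hv
    simp only [Finset.mem_product, mem_gridFace, Finset.mem_erase, Finset.mem_range]
    refine ⟨⟨fun i hi => ?_, fun i hi => ?_⟩, hv.1 j hj⟩
    · rw [Function.update_of_ne hi.1]; exact hv.1 i hi.2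
    · by_cases hij : i = j
      · subst hij; simp
      · rw [Function.update_of_ne hij]; exact hv.2 i (by tauto)
  · intro p hp
    simp only [Finset.mem_product, mem_gridFace, Finset.mem_erase, Finset.mem_range] at hp
    rw [mem_gridFace]
    refine ⟨fun i hi => ?_, fun i hi => ?_⟩
    · by_cases hij : i = j
      · subst hij; simpa using hp.2
      · rw [Function.update_of_ne hij]; exact hp.1.1 i ⟨hij, hi⟩
    · have hij : i ≠ j := fun h => hi (h ▸ hj)
      rw [Function.update_of_ne hij]; exact hp.1.2 i (by tauto)
  · intro v _; simp
  · intro p hp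
    simp only [Finset.mem_product, mem_gridFace] at hp
    have : p.1 j = N := hp.1.2 j (by simp)
    ext1 <;> simp [← this]
  · intro v _; simp

theorem sum_gridFace_diff (N : ℕ) {S : Finset ι} {j : ι} (hj : j ∈ S) (g : (ι → ℕ) → ZMod 2) :
    ∑ v ∈ gridFace N S, (g (v + Pi.single j 1) + g v) =
      ∑ v ∈ gridFace N (S.erase j), (g v + g (Function.update v j 0)) := by
  rw [sum_gridFace N hj]
  refine Finset.sum_congr rfl fun v hv => ?_
  have hvj : v j = N := (mem_gridFace.1 hv).2 j (by simp)
  have h1 : ∀ x, Function.update v j x + Pi.single j 1 = Function.update v j (x + 1) := by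
    intro x
    ext i
    by_cases hij : i = j
    · subst hij; simp
    · simp [hij]
  simp only [h1]
  have h2 := Finset.sum_range_sub (fun x => g (Function.update v j x)) N
  simp only [CharTwo.sub_eq_add] at h2
  rw [h2, ← hvj, Function.update_eq_self]

theorem sum_cubeCup_eq_one {N : ℕ}
    (h0 : ∀ a v, v a = 0 → u a v = 0) (h1 : ∀ a v, v a = N → u a v = 1) (l : List ι)
    (hl : l.Nodup) : ∑ v ∈ gridFace N l.toFinset, cubeCup u l l.toFinset v = 1 := by
  induction l with
  | nil =>
    have : gridFace N (∅ : Finset ι) = {fun _ => N} := by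
      ext v; simp [mem_gridFace, funext_iff]
    simp [cubeCup, this]
  | cons a l ih =>
    rw [List.nodup_cons] at hl
    set S := (a :: l).toFinset with hS
    have haS : a ∈ S := by simp [hS]
    have hSa : S.erase a = l.toFinset := by
      rw [hS, List.toFinset_cons, Finset.erase_insert (by simpa using hl.1)]
    have e1 : ∀ v, cubeCup u (a :: l) S v = ∑ j ∈ S,
        (u a (v + Pi.single j 1) * cubeCup u l (S.erase j) (v + Pi.single j 1)
          + u a v * cubeCup u l (S.erase j) v) := by
      intro v
      have h := cubeCup_closed u l S v
      have h' : ∑ j ∈ S, u a v * (cubeCup u l (S.erase j) (v + Pi.single j 1) +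
          cubeCup u l (S.erase j) v) = 0 := by rw [← Finset.mul_sum, h, mul_zero]
      simp only [cubeCup]
      rw [← sub_eq_zero, ← Finset.sum_sub_distrib, ← h']
      refine Finset.sum_congr rfl fun j _ => ?_
      rw [CharTwo.sub_eq_add]
      linear_combination zmod_two_add_self
        (u a (v + Pi.single j 1) * cubeCup u l (S.erase j) (v + Pi.single j 1))
    rw [Finset.sum_congr rfl fun v _ => e1 v, Finset.sum_comm,
      Finset.sum_congr rfl fun j hj => sum_gridFace_diff N hj
        (fun v => u a v * cubeCup u l (S.erase j) v),
      ← Finset.add_sum_erase S _ haS, Finset.sum_eq_zero (s := S.erase a), add_zero]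
    · rw [← ih hl.2, hSa]
      refine Finset.sum_congr rfl fun v hv => ?_
      rw [h1 a v ((mem_gridFace.1 hv).2 a (by simpa using hl.1)), h0 a _ (by simp)]
      simp
    · intro j hj
      rw [hSa, List.mem_toFinset] at hj
      refine Finset.sum_eq_zero fun v hv => ?_
      have hvj : v j = N := (mem_gridFace.1 hv).2 j (by simp)
      rw [cubeCup_eq_zero u hj, cubeCup_eq_zero u hj]
      · simp
      · intro w w' hw hw'
        have := hw j; have := hw' j
        rw [h0 j w (by simp_all), h0 j w' (by simp_all)]
      · intro w w' hw hw'
        have := hw j; have := hw' j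
        rw [h1 j w (by simp_all; omega), h1 j w' (by simp_all; omega)]

/-- Discrete Poincaré–Miranda theorem: if `u a` separates the two faces of the grid `[0, N]^ι`
orthogonal to `a`, for every `a`, then some unit cube of the grid has no `u a` constant on it. -/
theorem exists_cube_nonconstant {N : ℕ}
    (h0 : ∀ a v, v a = 0 → u a v = 0) (h1 : ∀ a v, v a = N → u a v = 1) :
    ∃ v : ι → ℕ, (∀ i, v i < N) ∧ ∀ a, ∃ w w' : ι → ℕ, (∀ i, v i ≤ w i ∧ w i ≤ v i + 1) ∧
      (∀ i, v i ≤ w' i ∧ w' i ≤ v i + 1) ∧ u a w ≠ u a w' := by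
  by_contra! H
  have h := sum_cubeCup_eq_one u h0 h1 (Finset.univ : Finset ι).toList (Finset.nodup_toList _)
  rw [Finset.toList_toFinset, Finset.sum_eq_zero] at h
  · exact zero_ne_one h
  · intro v hv
    obtain ⟨a, ha⟩ := H v fun i => (mem_gridFace.1 hv).1 i (Finset.mem_univ i)
    exact cubeCup_eq_zero u (a := a) (by simp) _ v fun w w' hw hw' =>
      ha w w' (by simpa using hw) (by simpa using hw')

end CubeCup

/-- A form of the Poincaré–Miranda (Lebesgue covering) theorem: partitions between the opposite
faces of a cube have a common point. -/
theorem exists_notMem_of_separates_faces {ι : Type*} [Fintype ι] {U W : ι → Set (ι → unitInterval)}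
    (hU : ∀ i, IsOpen (U i)) (hW : ∀ i, IsOpen (W i)) (hUW : ∀ i, Disjoint (U i) (W i))
    (h0 : ∀ i x, x i = 0 → x ∈ U i) (h1 : ∀ i x, x i = 1 → x ∈ W i) :
    ∃ x, ∀ i, x ∉ U i ∧ x ∉ W i := by
  classical
  by_contra! H
  set c : ι × Bool → Set (ι → unitInterval) := fun p => if p.2 then W p.1 else U p.1 with hc
  have hco : ∀ p, IsOpen (c p) := by
    rintro ⟨i, _ | _⟩
    · simpa [hc] using hU i
    · simpa [hc] using hW i
  have hcov : (univ : Set (ι → unitInterval)) ⊆ ⋃ p, c p := by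
    intro x _
    obtain ⟨i, hi⟩ := H x
    rw [mem_iUnion]
    by_cases hx : x ∈ U i
    · exact ⟨(i, false), by simpa [hc] using hx⟩
    · exact ⟨(i, true), by simpa [hc] using hi hx⟩
  obtain ⟨δ, hδ, hleb⟩ := lebesgue_number_lemma_of_metric isCompact_univ hco hcov
  obtain ⟨N, hN⟩ := exists_nat_one_div_lt hδ
  have hNpos : (0 : ℝ) < (N : ℝ) + 1 := by positivity
  set q : (ι → ℕ) → (ι → unitInterval) :=
    fun v i => projIcc 0 1 zero_le_one ((v i : ℝ) / (N + 1)) with hq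
  have hdist : ∀ v w : ι → ℕ, (∀ i, v i ≤ w i ∧ w i ≤ v i + 1) → dist (q w) (q v) < δ := by
    intro v w hvw
    rw [dist_pi_lt_iff hδ]
    intro i
    have hle : dist (q w i) (q v i) ≤ |(w i : ℝ) / (N + 1) - (v i : ℝ) / (N + 1)| := by
      rw [Subtype.dist_eq, Real.dist_eq]
      exact abs_projIcc_sub_projIcc zero_le_one
    refine hle.trans_lt (lt_of_le_of_lt ?_ hN)
    obtain ⟨ha, hb⟩ := hvw i
    have ha' : (v i : ℝ) ≤ w i := by exact_mod_cast ha
    have hb' : (w i : ℝ) ≤ v i + 1 := by exact_mod_cast hb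
    rw [← sub_div, abs_of_nonneg (by apply div_nonneg <;> linarith)]
    gcongr
    linarith
  have hz : ∀ i w, w i = 0 → (if q w ∈ U i then (0 : ZMod 2) else 1) = 0 := fun i w hw =>
    if_pos (h0 i _ (by simp [hq, hw]))
  have ho : ∀ i w, w i = N + 1 → (if q w ∈ U i then (0 : ZMod 2) else 1) = 1 := by
    intro i w hw
    refine if_neg fun h => disjoint_left.1 (hUW i) h (h1 i _ ?_)
    simp only [hq, hw]
    push_cast
    rw [div_self hNpos.ne']
    simp
  obtain ⟨v, -, hv⟩ := exists_cube_nonconstant _ hz ho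
  obtain ⟨⟨i, b⟩, hi⟩ := hleb (q v) (mem_univ _)
  obtain ⟨w, w', hw, hw', hne⟩ := hv i
  have hwc := hi (mem_ball.2 (hdist v w hw))
  have hwc' := hi (mem_ball.2 (hdist v w' hw'))
  apply hne
  cases b
  · simp only [hc] at hwc hwc'
    simp_all
  · simp only [hc, if_true] at hwc hwc'
    rw [if_neg fun h => disjoint_left.1 (hUW i) h hwc,
      if_neg fun h => disjoint_left.1 (hUW i) h hwc']

theorem indBelow_of_isInducing (n : ℕ) : ∀ {A : Type*} {B : Type*} [TopologicalSpace A]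
    [TopologicalSpace B] {f : A → B}, IsInducing f → indBelow n B → indBelow n A := by
  induction n with
  | zero =>
    intro A B _ _ f _ hB
    have : IsEmpty B := hB
    exact Function.isEmpty f
  | succ n ih =>
    intro A B _ _ f hf hB x U hU hx
    obtain ⟨U', hU', rfl⟩ := hf.isOpen_iff.1 hU
    obtain ⟨V, hV, hxV, hVU, hVn⟩ := hB (f x) U' hU' hx
    refine ⟨f ⁻¹' V, hV.preimage hf.continuous, hxV, preimage_mono hVU, ?_⟩
    have hm : MapsTo f (frontier (f ⁻¹' V)) (frontier V) :=
      fun y hy => hf.continuous.frontier_preimage_subset V hy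
    exact ih ((hf.comp IsInducing.subtypeVal).codRestrict fun y => hm y.2) hVn

theorem indBelow_mono {m n : ℕ} (h : m ≤ n) : ∀ {A : Type*} [TopologicalSpace A],
    indBelow m A → indBelow n A := by
  induction n generalizing m with
  | zero =>
    intro A _ hA
    rwa [Nat.le_zero.1 h] at hA
  | succ n ih =>
    intro A _ hA
    cases m with
    | zero =>
      have : IsEmpty A := hA
      exact fun x => isEmptyElim x
    | succ m =>
      intro x U hU hx
      obtain ⟨V, hV, hxV, hVU, hVn⟩ := hA x U hU hx
      exact ⟨V, hV, hxV, hVU, ih (Nat.le_of_succ_le_succ h) hVn⟩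

theorem indDim_le_iff {A : Type*} [TopologicalSpace A] {n : ℕ} :
    indDim A ≤ (n : EReal) - 1 ↔ indBelow n A := by
  constructor
  · intro h
    by_contra hn
    have : (n : EReal) ≤ indDim A := by
      refine le_sInf ?_
      rintro d ⟨k, hk, rfl⟩
      have hnk : n + 1 ≤ k := by
        by_contra! hlt
        exact hn (indBelow_mono (by omega) hk)
      obtain ⟨j, rfl⟩ := Nat.exists_eq_add_of_le hnk
      have : (((n + 1 + j : ℕ) : EReal)) - 1 = ((n + j : ℝ) : EReal) := by
        rw [show ((n + 1 + j : ℕ) : EReal) = ((n + 1 + j : ℝ) : EReal) by push_cast; rfl]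
        rw [← EReal.coe_one, ← EReal.coe_sub]
        congr 1; ring
      rw [this, show (n : EReal) = ((n : ℝ) : EReal) from rfl, EReal.coe_le_coe_iff]
      linarith [j.cast_nonneg (α := ℝ)]
    have h2 := this.trans h
    rw [show (n : EReal) = ((n : ℝ) : EReal) from rfl, ← EReal.coe_one, ← EReal.coe_sub,
      EReal.coe_le_coe_iff] at h2
    linarith
  · exact fun h => sInf_le ⟨n, h, rfl⟩

/-- A space with a base, each point of which lies on fewer than `n` of the frontiers of the members
of the base, has dimension at most `n - 1`. -/
theorem indBelow_of_frontiers {ι : Type*} (n : ℕ) : ∀ {A : Type*} [TopologicalSpace A]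
    (U : ι → Set A), (∀ i, IsOpen (U i)) →
    (∀ x O, IsOpen O → x ∈ O → ∃ i, x ∈ U i ∧ U i ⊆ O) →
    (∀ x (s : Finset ι), (∀ i ∈ s, x ∈ frontier (U i)) → s.card < n) → indBelow n A := by
  classical
  induction n with
  | zero =>
    intro A _ U _ _ h
    exact ⟨fun x => absurd (h x ∅ (by simp)) (by simp)⟩
  | succ n ih =>
    intro A _ U hU hbase hs x O hO hx
    obtain ⟨i, hxi, hiO⟩ := hbase x O hO hx
    refine ⟨U i, hU i, hxi, hiO, ih (fun j => Subtype.val ⁻¹' U j)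
      (fun j => (hU j).preimage continuous_subtype_val) ?_ ?_⟩
    · rintro y O' hO' hy
      obtain ⟨O'', hO'', rfl⟩ := isOpen_induced_iff.1 hO'
      obtain ⟨j, hj, hjO⟩ := hbase y O'' hO'' hy
      exact ⟨j, hj, preimage_mono hjO⟩
    · intro y s hy
      have hi : i ∉ s := by
        intro his
        have hempty : (Subtype.val ⁻¹' U i : Set (frontier (U i))) = ∅ := by
          refine eq_empty_of_forall_notMem fun z hz => ?_
          have hz' : (z : A) ∈ closure (U i) \ U i := (hU i).frontier_eq.subset z.2
          exact hz'.2 hz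
        have := hy i his
        rw [hempty, frontier_empty] at this
        exact this
      have := hs y (insert i s) ?_
      · rw [Finset.card_insert_of_notMem hi] at this; omega
      · intro j hj
        rcases Finset.mem_insert.1 hj with rfl | hj
        · exact y.2
        · exact continuous_subtype_val.frontier_preimage_subset _ (hy j hj)

/-- A closed set `M` splits along every pair of disjoint closed sets. -/
def SplitsAlong {T : Type*} [TopologicalSpace T] (M : Set T) : Prop :=
  ∀ A B : Set T, IsClosed A → IsClosed B → Disjoint A B →
    ∃ P Q : Set T, IsClosed P ∧ IsClosed Q ∧ Disjoint P Q ∧ P ∪ Q = M ∧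
      Disjoint P B ∧ Disjoint Q A

theorem splitsAlong_of_indBelow_one {T : Type*} [TopologicalSpace T] [SecondCountableTopology T]
    {M : Set T} (hM : IsClosed M) (h : indBelow 1 M) : SplitsAlong M := by
  classical
  intro A B hA hB hAB
  have hloc : ∀ x : M, ∃ V : Set M, IsOpen V ∧ x ∈ V ∧ IsClosed V ∧
      (Disjoint (Subtype.val '' V) A ∨ Disjoint (Subtype.val '' V) B) := by
    intro x
    have hx : (x : T) ∈ Aᶜ ∨ (x : T) ∈ Bᶜ := by
      by_contra! hcon
      simp only [mem_compl_iff, not_not] at hcon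
      exact disjoint_left.1 hAB hcon.1 hcon.2
    have hfr : ∀ V : Set M, IsOpen V → indBelow 0 (frontier V) → IsClosed V := by
      intro V hV hV0
      have h0 : IsEmpty (frontier V) := hV0
      have := isClopen_iff_frontier_eq_empty.2 (isEmpty_coe_sort.1 h0)
      exact this.1
    rcases hx with hx | hx
    · obtain ⟨V, hV, hxV, hVA, hV0⟩ := h x (Subtype.val ⁻¹' Aᶜ)
        (hA.isOpen_compl.preimage continuous_subtype_val) hx
      refine ⟨V, hV, hxV, hfr V hV hV0, Or.inl ?_⟩
      rw [disjoint_left]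
      rintro _ ⟨y, hy, rfl⟩
      exact hVA hy
    · obtain ⟨V, hV, hxV, hVA, hV0⟩ := h x (Subtype.val ⁻¹' Bᶜ)
        (hB.isOpen_compl.preimage continuous_subtype_val) hx
      refine ⟨V, hV, hxV, hfr V hV hV0, Or.inr ?_⟩
      rw [disjoint_left]
      rintro _ ⟨y, hy, rfl⟩
      exact hVA hy
  choose V hVo hxV hVc hVAB using hloc
  obtain ⟨D, hD, hDcov⟩ := isOpen_iUnion_countable V hVo
  have hcov : ⋃ i ∈ D, V i = univ := by
    rw [hDcov]; exact iUnion_eq_univ_iff.2 fun x => ⟨x, hxV x⟩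
  rcases D.eq_empty_or_nonempty with rfl | hDne
  · have hMe : M = ∅ := by
      rw [← Subtype.range_coe (s := M), ← image_univ, ← hcov]; simp
    exact ⟨∅, ∅, isClosed_empty, isClosed_empty, by simp, by simp [hMe], by simp, by simp⟩
  obtain ⟨e, he⟩ := hD.exists_eq_range hDne
  set R : ℕ → Set M := disjointed fun k => V (e k) with hR
  have hRo : ∀ k, IsOpen (R k) := fun k =>
    disjointedRec (p := IsOpen) (fun _ _ ht => IsOpen.sdiff ht (hVc _)) (hVo _)
  have hRcov : ⋃ k, R k = univ := by
    rw [hR, iUnion_disjointed, ← hcov, he, biUnion_range]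
  have hRd : Pairwise (Function.onFun Disjoint R) := disjoint_disjointed _
  have hRsub : ∀ k, R k ⊆ V (e k) := fun k => disjointed_subset _ k
  set I : Set ℕ := {k | Disjoint (Subtype.val '' V (e k)) B} with hI
  set P : Set M := ⋃ k ∈ I, R k with hP
  set Q : Set M := ⋃ k ∈ Iᶜ, R k with hQ
  have hPQ : Pᶜ = Q := by
    ext x
    constructor
    · intro hx
      obtain ⟨k, hk⟩ := mem_iUnion.1 (hRcov.symm ▸ mem_univ x : x ∈ ⋃ k, R k)
      exact mem_biUnion (fun hkI => hx (mem_biUnion hkI hk)) hk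
    · intro hx hx'
      obtain ⟨k, hk, hxk⟩ := mem_iUnion₂.1 hx
      obtain ⟨j, hj, hxj⟩ := mem_iUnion₂.1 hx'
      have : k = j := by
        by_contra hne
        exact disjoint_left.1 (hRd hne) hxk hxj
      exact hk (this ▸ hj)
  have hPo : IsOpen P := isOpen_biUnion fun k _ => hRo k
  have hQo : IsOpen Q := isOpen_biUnion fun k _ => hRo k
  have hQc : IsClosed Q := by rw [← hPQ]; exact hPo.isClosed_compl
  have hPc : IsClosed P := by rw [← compl_compl P, hPQ]; exact hQo.isClosed_compl
  have hdis : Disjoint P Q := by rw [← hPQ]; exact disjoint_compl_right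
  refine ⟨Subtype.val '' P, Subtype.val '' Q, hM.isClosedEmbedding_subtypeVal.isClosedMap _ hPc,
    hM.isClosedEmbedding_subtypeVal.isClosedMap _ hQc,
    (disjoint_image_iff Subtype.val_injective).2 hdis, ?_, ?_, ?_⟩
  · rw [← image_union, ← hPQ, union_compl_self, image_univ, Subtype.range_coe]
  · rw [disjoint_left]
    rintro _ ⟨x, hx, rfl⟩
    obtain ⟨k, hk, hxk⟩ := mem_iUnion₂.1 hx
    exact disjoint_left.1 hk ⟨x, hRsub k hxk, rfl⟩
  · rw [disjoint_left]
    rintro _ ⟨x, hx, rfl⟩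
    obtain ⟨k, hk, hxk⟩ := mem_iUnion₂.1 hx
    exact disjoint_left.1 ((hVAB (e k)).resolve_right hk) ⟨x, hRsub k hxk, rfl⟩

/-- The countable closed sum theorem in dimension zero. -/
theorem exists_isClopen_of_splitsAlong {T : Type*} [TopologicalSpace T] [NormalSpace T]
    {M : ℕ → Set T} (hM : ∀ i, SplitsAlong (M i)) (hcov : ⋃ i, M i = univ)
    {A B : Set T} (hA : IsClosed A) (hB : IsClosed B) (hAB : Disjoint A B) :
    ∃ C : Set T, IsClopen C ∧ A ⊆ C ∧ Disjoint C B := by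
  let S := {p : Set T × Set T // IsClosed p.1 ∧ IsClosed p.2 ∧ Disjoint p.1 p.2}
  have step : ∀ (i : ℕ) (p : S), ∃ q : S, p.1.1 ⊆ interior q.1.1 ∧ p.1.2 ⊆ interior q.1.2 ∧
      M i ⊆ q.1.1 ∪ q.1.2 := by
    rintro i ⟨⟨A, B⟩, hA, hB, hAB⟩
    obtain ⟨P, Q, hP, hQ, hPQ, hM, hPB, hQA⟩ := hM i A B hA hB hAB
    have hd : Disjoint (A ∪ P) (B ∪ Q) := by
      simp only [disjoint_union_left, disjoint_union_right]
      exact ⟨⟨hAB, hPB⟩, hQA.symm, hPQ⟩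
    obtain ⟨U, W, hU, hW, hAU, hBW, hUW⟩ :=
      normal_separation (hA.union hP) (hB.union hQ) hd
    obtain ⟨U', hU', hAU', hUU'⟩ := normal_exists_closure_subset (hA.union hP) hU hAU
    obtain ⟨W', hW', hBW', hWW'⟩ := normal_exists_closure_subset (hB.union hQ) hW hBW
    refine ⟨⟨(closure U', closure W'), isClosed_closure, isClosed_closure,
      hUW.mono hUU' hWW'⟩, ?_, ?_, ?_⟩
    · exact (subset_union_left.trans hAU').trans (interior_maximal subset_closure hU')
    · exact (subset_union_left.trans hBW').trans (interior_maximal subset_closure hW')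
    · rw [← hM]
      exact union_subset_union ((subset_union_right.trans hAU').trans subset_closure)
        ((subset_union_right.trans hBW').trans subset_closure)
  choose next hnA hnB hnM using step
  let p : ℕ → S := fun k => Nat.rec ⟨(A, B), hA, hB, hAB⟩ next k
  have hp : ∀ k, p (k + 1) = next k (p k) := fun k => rfl
  have hmA : Monotone fun k => (p k).1.1 :=
    monotone_nat_of_le_succ fun k => (hnA k (p k)).trans interior_subset
  have hmB : Monotone fun k => (p k).1.2 :=
    monotone_nat_of_le_succ fun k => (hnB k (p k)).trans interior_subset
  have ho : ∀ f : ℕ → Set T, (∀ k, f k ⊆ interior (f (k + 1))) → IsOpen (⋃ k, f k) := by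
    intro f hf
    have : ⋃ k, f k = ⋃ k, interior (f (k + 1)) := by
      apply subset_antisymm
      · exact iUnion_mono hf
      · exact iUnion_subset fun k => interior_subset.trans (subset_iUnion f (k + 1))
    rw [this]
    exact isOpen_iUnion fun k => isOpen_interior
  have hoA := ho (fun k => (p k).1.1) fun k => hnA k (p k)
  have hoB := ho (fun k => (p k).1.2) fun k => hnB k (p k)
  have hdis : Disjoint (⋃ k, (p k).1.1) (⋃ k, (p k).1.2) := by
    rw [disjoint_left]
    intro x hx hx'
    obtain ⟨j, hj⟩ := mem_iUnion.1 hx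
    obtain ⟨k, hk⟩ := mem_iUnion.1 hx'
    exact disjoint_left.1 (p (max j k)).2.2.2 (hmA (le_max_left j k) hj)
      (hmB (le_max_right j k) hk)
  have hcompl : (⋃ k, (p k).1.1)ᶜ = ⋃ k, (p k).1.2 := by
    apply subset_antisymm
    · intro x hx
      obtain ⟨i, hi⟩ := mem_iUnion.1 (hcov.symm ▸ mem_univ x : x ∈ ⋃ i, M i)
      rcases hnM i (p i) hi with h | h
      · exact absurd (mem_iUnion.2 ⟨i + 1, h⟩) hx
      · exact mem_iUnion.2 ⟨i + 1, h⟩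
    · exact fun x hx hx' => disjoint_left.1 hdis hx' hx
  refine ⟨⋃ k, (p k).1.1, ⟨?_, hoA⟩, subset_iUnion (fun k => (p k).1.1) 0, ?_⟩
  · rw [← compl_compl (⋃ k, (p k).1.1), hcompl]
    exact hoB.isClosed_compl
  · exact hdis.mono_right (subset_iUnion (fun k => (p k).1.2) 0)

theorem exists_isOpen_of_indBelow_succ {Y : Type*} [TopologicalSpace Y] {E : Set Y} {n : ℕ}
    (h : indBelow (n + 1) E) {x : Y} (hx : x ∈ E) {O : Set Y} (hO : IsOpen O) (hxO : x ∈ O) :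
    ∃ V, IsOpen V ∧ x ∈ V ∧ V ∩ E ⊆ O ∧ indBelow n ↥(E ∩ (closure (V ∩ E) \ V)) := by
  obtain ⟨V', hV', hxV, hVO, hn⟩ :=
    h ⟨x, hx⟩ (Subtype.val ⁻¹' O) (hO.preimage continuous_subtype_val) hxO
  obtain ⟨V, hV, rfl⟩ := isOpen_induced_iff.1 hV'
  refine ⟨V, hV, hxV, fun y hy => @hVO ⟨y, hy.2⟩ hy.1, ?_⟩
  have hm : ∀ y : ↥(E ∩ (closure (V ∩ E) \ V)),
      (⟨y, y.2.1⟩ : E) ∈ frontier (Subtype.val ⁻¹' V : Set E) := by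
    intro y
    rw [hV'.frontier_eq]
    refine ⟨?_, y.2.2.2⟩
    rw [closure_subtype, Subtype.image_preimage_coe, inter_comm]
    exact y.2.2.1
  exact indBelow_of_isInducing n ((IsInducing.subtypeVal.codRestrict fun y => y.2.1).codRestrict hm)
    hn

/-- `E` is covered by countably many closed sets, whose traces on `E` have dimension at most
`n - 1`. -/
def CountableClosedSum {Y : Type*} [TopologicalSpace Y] (n : ℕ) (E : Set Y) : Prop :=
  ∃ 𝒟 : Set (Set Y), 𝒟.Countable ∧ (∀ D ∈ 𝒟, IsClosed D ∧ indBelow n ↥(E ∩ D)) ∧ E ⊆ ⋃₀ 𝒟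

theorem CountableClosedSum.exists_decomposition {Y : Type*} [TopologicalSpace Y]
    [SecondCountableTopology Y] {n : ℕ} {E : Set Y} (h : CountableClosedSum (n + 1) E) :
    ∃ E' : Set Y, CountableClosedSum n E' ∧ CountableClosedSum 1 (E \ E') := by
  obtain ⟨𝒞, h𝒞, hC, hE⟩ := h
  let Good (C s t V : Set Y) : Prop := IsOpen V ∧ s ∩ (E ∩ C) ⊆ V ∧ V ∩ (E ∩ C) ⊆ t ∧
    indBelow n ↥((E ∩ C) ∩ (closure (V ∩ (E ∩ C)) \ V))
  have hcho : ∀ C s t, ∃ V, (∃ V', Good C s t V') → Good C s t V := by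
    intro C s t
    by_cases hex : ∃ V', Good C s t V'
    · exact ⟨hex.choose, fun _ => hex.choose_spec⟩
    · exact ⟨∅, fun h => absurd h hex⟩
  choose V hV using hcho
  let D (C s t : Set Y) : Set Y := C ∩ (closure (V C s t ∩ (E ∩ C)) \ V C s t)
  let K : Set (Set Y × Set Y × Set Y) := 𝒞 ×ˢ (countableBasis Y ×ˢ countableBasis Y)
  have hK : K.Countable := h𝒞.prod ((countable_countableBasis Y).prod (countable_countableBasis Y))
  let 𝒟 : Set (Set Y) := (fun p => D p.1 p.2.1 p.2.2) ''
    {p ∈ K | Good p.1 p.2.1 p.2.2 (V p.1 p.2.1 p.2.2)}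
  refine ⟨E ∩ ⋃₀ 𝒟, ⟨𝒟, (hK.mono (sep_subset _ _)).image _, ?_, inter_subset_right⟩,
    𝒞, h𝒞, fun C hCm => ⟨(hC C hCm).1, ?_⟩, sdiff_subset.trans hE⟩
  · rintro _ ⟨⟨C, s, t⟩, ⟨hp, hg⟩, rfl⟩
    refine ⟨(hC C hp.1).1.inter (isClosed_closure.sdiff hg.1), ?_⟩
    refine indBelow_of_isInducing n (IsInducing.subtypeVal.codRestrict
      (s := (E ∩ C) ∩ (closure (V C s t ∩ (E ∩ C)) \ V C s t)) ?_) hg.2.2.2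
    exact fun y => ⟨⟨y.2.1.1, y.2.2.1⟩, y.2.2.2⟩
  · rintro ⟨x, hx⟩ O' hO' hxO'
    obtain ⟨O, hO, rfl⟩ := isOpen_induced_iff.1 hO'
    have hxEC : x ∈ E ∩ C := ⟨hx.1.1, hx.2⟩
    obtain ⟨t, ht, hxt, htO⟩ := (isBasis_countableBasis Y).exists_subset_of_mem_open
      (show x ∈ O from hxO') hO
    obtain ⟨V₀, hV₀, hxV₀, hV₀t, hV₀n⟩ := exists_isOpen_of_indBelow_succ (hC C hCm).2 hxEC
      (isOpen_of_mem_countableBasis ht) hxt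
    obtain ⟨s, hs, hxs, hsV⟩ := (isBasis_countableBasis Y).exists_subset_of_mem_open hxV₀ hV₀
    have hg : Good C s t (V C s t) :=
      hV C s t ⟨V₀, hV₀, inter_subset_left.trans hsV, hV₀t, hV₀n⟩
    refine ⟨Subtype.val ⁻¹' V C s t, hg.1.preimage continuous_subtype_val, hg.2.1 ⟨hxs, hxEC⟩,
      fun y hy => htO (hg.2.2.1 ⟨hy, y.2.1.1, y.2.2⟩), ?_⟩
    refine isEmpty_coe_sort.2 (eq_empty_of_forall_notMem fun y hy => ?_)
    rw [(hg.1.preimage continuous_subtype_val).frontier_eq] at hy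
    refine y.2.1.2 ⟨y.2.1.1, D C s t, ⟨(C, s, t), ⟨⟨hCm, hs, ht⟩, hg⟩, rfl⟩, y.2.2, ?_, hy.2⟩
    have h1 := closure_subtype.1 hy.1
    refine closure_mono ?_ h1
    rintro _ ⟨z, hz, rfl⟩
    exact ⟨hz, z.2.1.1, z.2.2⟩

/-- Any two disjoint closed sets are separated by a partition missing `Z`. -/
def HasPartitionsMissing {Y : Type*} [TopologicalSpace Y] (Z : Set Y) : Prop :=
  ∀ A B : Set Y, IsClosed A → IsClosed B → Disjoint A B →
    ∃ U W : Set Y, IsOpen U ∧ IsOpen W ∧ Disjoint U W ∧ A ⊆ U ∧ B ⊆ W ∧ Z ⊆ U ∪ W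

theorem CountableClosedSum.hasPartitionsMissing {Y : Type*} [TopologicalSpace Y]
    [SecondCountableTopology Y] [CompletelyNormalSpace Y] {Z : Set Y}
    (h : CountableClosedSum 1 Z) : HasPartitionsMissing Z := by
  intro A B hA hB hAB
  obtain ⟨𝒟, h𝒟, hD, hZ⟩ := h
  have hne : (insert ∅ 𝒟).Nonempty := insert_nonempty _ _
  obtain ⟨e, he⟩ := (h𝒟.insert ∅).exists_eq_range hne
  have heC : ∀ i, IsClosed (e i) ∧ indBelow 1 ↥(Z ∩ e i) := by
    intro i
    have : e i ∈ insert ∅ 𝒟 := he ▸ mem_range_self i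
    rcases this with hi | hi
    · rw [hi]
      exact ⟨isClosed_empty, fun x => absurd x.2.2 (notMem_empty _)⟩
    · exact hD _ hi
  have hsplit : ∀ i, SplitsAlong (Subtype.val ⁻¹' e i : Set Z) := by
    intro i
    refine splitsAlong_of_indBelow_one ((heC i).1.preimage continuous_subtype_val) ?_
    exact indBelow_of_isInducing 1 ((IsInducing.subtypeVal.comp IsInducing.subtypeVal).codRestrict
      (s := Z ∩ e i) fun y => ⟨y.1.2, y.2⟩) (heC i).2
  have hcov : ⋃ i, (Subtype.val ⁻¹' e i : Set Z) = univ := by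
    refine eq_univ_of_forall fun z => ?_
    obtain ⟨D, hDm, hz⟩ := hZ z.2
    obtain ⟨i, hi⟩ : D ∈ range e := he ▸ mem_insert_of_mem _ hDm
    exact mem_iUnion.2 ⟨i, by rw [hi]; exact hz⟩
  obtain ⟨U₀, W₀, hU₀, hW₀, hAU, hBW, hUW₀⟩ := normal_separation hA hB hAB
  obtain ⟨A', hA', hAA', hAU'⟩ := normal_exists_closure_subset hA hU₀ hAU
  obtain ⟨B', hB', hBB', hBW'⟩ := normal_exists_closure_subset hB hW₀ hBW
  obtain ⟨C, hC, hAC, hCB⟩ := exists_isClopen_of_splitsAlong hsplit hcov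
    (A := Subtype.val ⁻¹' closure A') (B := Subtype.val ⁻¹' closure B')
    (isClosed_closure.preimage continuous_subtype_val)
    (isClosed_closure.preimage continuous_subtype_val)
    ((hUW₀.mono hAU' hBW').preimage _)
  have hsep : ∀ (A B A' : Set Y) (C : Set Z), IsClosed A → IsOpen A' → A ⊆ A' → IsClopen C →
      Disjoint A B → Disjoint A' (Subtype.val '' Cᶜ) → Disjoint (closure B) (Subtype.val '' C) →
      IsClosed B →
      Disjoint (A ∪ Subtype.val '' C) (closure (B ∪ Subtype.val '' Cᶜ)) := by
    intro A B A' C hA hA' hAA' hC hAB hA'C hBC hB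
    rw [closure_union, hB.closure_eq]
    rw [hB.closure_eq] at hBC
    simp only [disjoint_union_left, disjoint_union_right]
    refine ⟨⟨hAB, hBC.symm⟩, (hA'C.closure_right hA').mono_left hAA', ?_⟩
    rw [disjoint_left]
    rintro _ ⟨z, hz, rfl⟩ hz'
    have : z ∈ closure Cᶜ := closure_subtype.2 hz'
    rw [hC.compl.1.closure_eq] at this
    exact this hz
  have hA'C : Disjoint A' (Subtype.val '' Cᶜ) := by
    rw [disjoint_left]
    rintro _ hz ⟨z, hzC, rfl⟩
    exact hzC (hAC (subset_closure hz))
  have hB'C : Disjoint B' (Subtype.val '' C) := by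
    rw [disjoint_left]
    rintro _ hz ⟨z, hzC, rfl⟩
    exact disjoint_left.1 hCB hzC (subset_closure hz)
  have h1 := hsep A B A' C hA hA' hAA' hC hAB hA'C
    (by rw [hB.closure_eq]; exact hB'C.mono_left hBB') hB
  have h2 := hsep B A B' Cᶜ hB hB' hBB' hC.compl hAB.symm (by rwa [compl_compl])
    (by rw [hA.closure_eq]; exact hA'C.mono_left hAA') hA
  rw [compl_compl] at h2
  obtain ⟨U, W, hU, hW, hCU, hCW, hUW⟩ :=
    separatedNhds_iff_disjoint.2 (completely_normal h2.symm h1)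
  refine ⟨U, W, hU, hW, hUW, subset_union_left.trans hCU, subset_union_left.trans hCW, ?_⟩
  intro z hz
  by_cases hzC : (⟨z, hz⟩ : Z) ∈ C
  · exact Or.inl (hCU (Or.inr ⟨_, hzC, rfl⟩))
  · exact Or.inr (hCW (Or.inr ⟨_, hzC, rfl⟩))

theorem CountableClosedSum.exists_cover {Y : Type*} [TopologicalSpace Y]
    [SecondCountableTopology Y] [CompletelyNormalSpace Y] {n : ℕ} {E : Set Y}
    (h : CountableClosedSum n E) :
    ∃ Z : Fin n → Set Y, E ⊆ ⋃ k, Z k ∧ ∀ k, HasPartitionsMissing (Z k) := by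
  induction n generalizing E with
  | zero =>
    obtain ⟨𝒟, -, hD, hE⟩ := h
    refine ⟨fun _ => ∅, fun x hx => ?_, fun k => k.elim0⟩
    obtain ⟨D, hDm, hxD⟩ := hE hx
    have hem : IsEmpty ↥(E ∩ D) := (hD D hDm).2
    exact hem.elim ⟨x, hx, hxD⟩
  | succ n ih =>
    obtain ⟨E', hE', hd⟩ := h.exists_decomposition
    obtain ⟨Z, hZ, hZp⟩ := ih hE'
    refine ⟨Fin.cons (E \ E') Z, fun x hx => ?_, Fin.cases hd.hasPartitionsMissing hZp⟩
    by_cases hxE : x ∈ E'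
    · obtain ⟨k, hk⟩ := mem_iUnion.1 (hZ hxE)
      exact mem_iUnion.2 ⟨k.succ, hk⟩
    · exact mem_iUnion.2 ⟨0, hx, hxE⟩

/-- The cube `[0, 1]^n` has topological dimension at least `n`. -/
theorem not_indBelow_cube (n : ℕ) : ¬ indBelow n (Fin n → unitInterval) := by
  intro h
  have hsum : CountableClosedSum n (univ : Set (Fin n → unitInterval)) :=
    ⟨{univ}, countable_singleton _, by
      rintro _ rfl
      exact ⟨isClosed_univ, indBelow_of_isInducing n IsInducing.subtypeVal h⟩, by simp⟩
  obtain ⟨Z, hZ, hZp⟩ := hsum.exists_cover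
  choose U W hU hW hUW h0 h1 hcov using fun k => hZp k {x | x k = 0} {x | x k = 1}
    (isClosed_eq (continuous_apply k) continuous_const)
    (isClosed_eq (continuous_apply k) continuous_const)
    (disjoint_left.2 fun x hx hx' => zero_ne_one (hx.symm.trans hx'))
  obtain ⟨x, hx⟩ := exists_notMem_of_separates_faces hU hW hUW (fun i x hx => h0 i hx)
    (fun i x hx => h1 i hx)
  obtain ⟨k, hk⟩ := mem_iUnion.1 (hZ (mem_univ x))
  rcases hcov k hk with h | h
  · exact (hx k).1 h
  · exact (hx k).2 h

/-- Countably many perturbations of the coordinate functionals of `Fin n → ℝ`, any `n` of which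
(from distinct indices) have trivial common kernel. -/
theorem exists_linearMaps_general_position (n : ℕ) :
    ∃ L : ℕ → Fin n → ((Fin n → ℝ) →ₗ[ℝ] ℝ),
      (∀ i k z, |L i k z - z k| ≤ ‖z‖ / 2) ∧
      ∀ s : Finset ℕ, s.card = n → ∀ (k : ℕ → Fin n) (z : Fin n → ℝ),
        (∀ i ∈ s, L i (k i) z = 0) → z = 0 := by
  classical
  let v : Fin n → ℝ := fun j => (j : ℝ)
  have hv : Set.InjOn v (Finset.univ : Finset (Fin n)) := fun a _ b _ h => by
    simpa [v, Fin.ext_iff] using h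
  have hδ : ∃ δ : ℝ, 0 < δ ∧ δ < 1 ∧ ∀ k j : Fin n, ∀ x : ℝ, |x - k| < δ →
      |(Lagrange.basis Finset.univ v j).eval x - (Lagrange.basis Finset.univ v j).eval (k : ℝ)| ≤
        1 / (2 * n) := by
    have : ∀ᶠ δ : ℝ in 𝓝[>] 0, ∀ k j : Fin n, ∀ x : ℝ, |x - k| < δ →
        |(Lagrange.basis Finset.univ v j).eval x -
          (Lagrange.basis Finset.univ v j).eval (k : ℝ)| ≤ 1 / (2 * n) := by
      refine eventually_all.2 fun k => eventually_all.2 fun j => ?_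
      have hn : (0 : ℝ) < n := by exact_mod_cast k.pos
      obtain ⟨ε, hε, h⟩ := Metric.continuousAt_iff.1
        ((Lagrange.basis Finset.univ v j).continuous.continuousAt (x := (k : ℝ)))
        (1 / (2 * n)) (by positivity)
      filter_upwards [Ioo_mem_nhdsGT hε] with δ hδ x hx
      exact (h (by rw [Real.dist_eq]; exact hx.trans hδ.2)).le
    obtain ⟨δ, h, h'⟩ := (this.and (Ioo_mem_nhdsGT one_pos)).exists
    exact ⟨δ, h'.1, h'.2, h⟩
  obtain ⟨δ, hδ0, hδ1, hδ⟩ := hδ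
  let lam : ℕ → Fin n → ℝ := fun i k => k + δ / (i + 2)
  have hfrac : ∀ i : ℕ, 0 < δ / ((i : ℝ) + 2) ∧ δ / ((i : ℝ) + 2) < δ := fun i =>
    ⟨by positivity, div_lt_self hδ0 (by linarith [(Nat.cast_nonneg i : (0 : ℝ) ≤ i)])⟩
  let L : ℕ → Fin n → ((Fin n → ℝ) →ₗ[ℝ] ℝ) := fun i k =>
    (Polynomial.leval (lam i k)).comp (Lagrange.interpolate Finset.univ v)
  have hL : ∀ i k z, L i k z = (Lagrange.interpolate Finset.univ v z).eval (lam i k) :=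
    fun _ _ _ => rfl
  refine ⟨L, fun i k z => ?_, fun s hs k z hz => ?_⟩
  · have hn : (0 : ℝ) < n := by exact_mod_cast k.pos
    have hk : z k = (Lagrange.interpolate Finset.univ v z).eval (k : ℝ) :=
      (Lagrange.eval_interpolate_at_node z hv (Finset.mem_univ k)).symm
    rw [hL, hk, Lagrange.interpolate_apply, Polynomial.eval_finsetSum,
      Polynomial.eval_finsetSum, ← Finset.sum_sub_distrib]
    refine (Finset.abs_sum_le_sum_abs _ _).trans ?_
    calc _ ≤ ∑ _j : Fin n, ‖z‖ * (1 / (2 * n)) := by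
          refine Finset.sum_le_sum fun j _ => ?_
          rw [Polynomial.eval_mul, Polynomial.eval_mul, Polynomial.eval_C, Polynomial.eval_C,
            ← mul_sub, abs_mul]
          refine mul_le_mul (norm_le_pi_norm z j) (hδ k j _ ?_) (abs_nonneg _) (norm_nonneg _)
          simp only [lam, add_sub_cancel_left]
          rw [abs_of_pos (hfrac i).1]
          exact (hfrac i).2
      _ = ‖z‖ / 2 := by
          rw [Finset.sum_const, Finset.card_univ, Fintype.card_fin, nsmul_eq_mul]
          field_simp
  · have hinj : Set.InjOn (fun i => lam i (k i)) s := by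
      intro i _ j _ hij
      have hij : ((k i : ℕ) : ℝ) + δ / (i + 2) = (k j : ℕ) + δ / (j + 2) := hij
      have hkk : (k i : ℕ) = k j := by
        have h1 : ((k i : ℕ) : ℝ) < (k j : ℕ) + 1 := by linarith [hfrac i, hfrac j]
        have h2 : ((k j : ℕ) : ℝ) < (k i : ℕ) + 1 := by linarith [hfrac i, hfrac j]
        have h1 : (k i : ℕ) < k j + 1 := by exact_mod_cast h1
        have h2 : (k j : ℕ) < k i + 1 := by exact_mod_cast h2
        omega
      rw [hkk] at hij
      have := add_left_cancel hij
      rw [div_eq_div_iff (by positivity) (by positivity)] at this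
      have := mul_left_cancel₀ hδ0.ne' this
      have : (j : ℝ) = i := by linarith
      exact_mod_cast this.symm
    have h0 : Lagrange.interpolate Finset.univ v z = 0 := by
      refine Polynomial.eq_zero_of_degree_lt_of_eval_index_eq_zero _ hinj ?_ hz
      rw [hs]
      simpa using Lagrange.degree_interpolate_lt z hv
    funext j
    rw [← Lagrange.eval_interpolate_at_node z hv (Finset.mem_univ j), h0]
    simp

theorem exists_isOpen_cover_of_hausdorffMeasure_eq_zero {Y : Type*} [MetricSpace Y]
    [MeasurableSpace Y] [BorelSpace Y] {d : ℝ} (hd : 0 < d) {A : Set Y}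
    (hA : MeasureTheory.Measure.hausdorffMeasure d A = 0) {ε : ℝ≥0∞} (hε : 0 < ε) :
    ∃ V : ℕ → Set Y, (∀ i, IsOpen (V i)) ∧ A ⊆ ⋃ i, V i ∧ (∀ i, ediam (V i) ≤ ε) ∧
      ∑' i, ediam (V i) ^ d ≤ ε := by
  have hε2 : 0 < ε / 2 := ENNReal.half_pos hε.ne'
  have h0 : (⨅ (t : ℕ → Set Y) (_ : A ⊆ ⋃ n, t n) (_ : ∀ n, ediam (t n) ≤ ε / 2),
      ∑' n, ⨆ _ : (t n).Nonempty, ediam (t n) ^ d) < ε / 2 := by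
    refine lt_of_le_of_lt ?_ hε2
    rw [← hA, MeasureTheory.Measure.hausdorffMeasure_apply]
    exact le_iSup₂_of_le (ε / 2) hε2 le_rfl
  simp only [iInf_lt_iff] at h0
  obtain ⟨t, hAt, htd, hts⟩ := h0
  obtain ⟨η, hη0, hη⟩ := ENNReal.exists_pos_sum_of_countable' hε2.ne' ℕ
  have hV : ∀ i, ∃ V : Set Y, IsOpen V ∧ t i ⊆ V ∧ ediam V ≤ ε ∧
      ediam V ^ d ≤ (⨆ _ : (t i).Nonempty, ediam (t i) ^ d) + η i := by
    intro i
    rcases (t i).eq_empty_or_nonempty with hi | hi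
    · exact ⟨∅, isOpen_empty, hi.le, by simp, by simp [hd]⟩
    have hfin : ediam (t i) ^ d ≠ ∞ := by
      refine ((ENNReal.le_tsum i).trans_lt (hts.trans_le le_top)).ne_top ∘ fun h => ?_
      simpa [hi] using h
    have h1 : ∀ᶠ r : ℝ≥0 in 𝓝 0, (ediam (t i) + 2 * r) ^ d < ediam (t i) ^ d + η i := by
      have hc : Continuous fun r : ℝ≥0 => (ediam (t i) + 2 * (r : ℝ≥0∞)) ^ d :=
        ENNReal.continuous_rpow_const.comp (continuous_const.add
          ((ENNReal.continuous_const_mul (by simp)).comp ENNReal.continuous_coe))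
      refine hc.continuousAt.eventually_lt continuousAt_const ?_
      simpa using ENNReal.lt_add_right hfin (hη0 i).ne'
    have h2 : ∀ᶠ r : ℝ≥0 in 𝓝 0, 2 * (r : ℝ≥0∞) < ε / 2 := by
      have hc : Continuous fun r : ℝ≥0 => 2 * (r : ℝ≥0∞) :=
        (ENNReal.continuous_const_mul (by simp)).comp ENNReal.continuous_coe
      refine hc.continuousAt.eventually_lt continuousAt_const ?_
      simpa using hε2
    obtain ⟨r, ⟨hr1, hr2⟩, hr0⟩ := (((h1.and h2).filter_mono nhdsWithin_le_nhds).and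
      (self_mem_nhdsWithin : Ioi (0 : ℝ≥0) ∈ 𝓝[>] 0)).exists
    refine ⟨thickening r (t i), isOpen_thickening, self_subset_thickening (by exact_mod_cast hr0) _,
      ?_, ?_⟩
    · refine (ediam_thickening_le r).trans ?_
      calc _ ≤ ε / 2 + ε / 2 := add_le_add (htd i) hr2.le
        _ = ε := ENNReal.add_halves ε
    · simp only [hi, iSup_pos]
      exact (ENNReal.rpow_le_rpow (ediam_thickening_le r) hd.le).trans hr1.le
  choose V hVo htV hVd hVs using hV
  refine ⟨V, hVo, hAt.trans (iUnion_mono htV), hVd, ?_⟩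
  calc _ ≤ ∑' i, ((⨆ _ : (t i).Nonempty, ediam (t i) ^ d) + η i) := ENNReal.tsum_le_tsum hVs
    _ = _ := ENNReal.tsum_add
    _ ≤ ε / 2 + ε / 2 := add_le_add hts.le hη.le
    _ = ε := ENNReal.add_halves ε

theorem exists_isOpen_hausdorffMeasure_iInter_eq_zero {Y : Type*} [MetricSpace Y]
    [MeasurableSpace Y] [BorelSpace Y] {d : ℝ} (hd : 0 < d) {A : Set Y}
    (hA : MeasureTheory.Measure.hausdorffMeasure d A = 0) :
    ∃ O : ℕ → Set Y, (∀ m, IsOpen (O m)) ∧ A ⊆ ⋂ m, O m ∧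
      MeasureTheory.Measure.hausdorffMeasure d (⋂ m, O m) = 0 := by
  have hpos : ∀ m : ℕ, 0 < ((m : ℝ≥0∞) + 1)⁻¹ := fun m =>
    ENNReal.inv_pos.2 (ENNReal.add_ne_top.2 ⟨ENNReal.natCast_ne_top m, ENNReal.one_ne_top⟩)
  choose V hVo hAV hVd hVs using fun m : ℕ =>
    exists_isOpen_cover_of_hausdorffMeasure_eq_zero hd hA (hpos m)
  have hlim : Tendsto (fun m : ℕ => ((m : ℝ≥0∞) + 1)⁻¹) atTop (𝓝 0) := by
    have := ENNReal.tendsto_inv_nat_nhds_zero.comp (tendsto_add_atTop_nat 1)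
    simpa [Function.comp_def] using this
  refine ⟨fun m => ⋃ i, V m i, fun m => isOpen_iUnion (hVo m), subset_iInter hAV, ?_⟩
  refine le_antisymm ?_ zero_le
  refine (MeasureTheory.Measure.hausdorffMeasure_le_liminf_tsum d _ _ hlim V
    (Eventually.of_forall hVd) (Eventually.of_forall fun m => iInter_subset _ m)).trans ?_
  rw [← hlim.liminf_eq]
  exact liminf_le_liminf (Eventually.of_forall hVs)

/-- Every subset of a metric space has a `G_δ` hull of the same Hausdorff dimension. -/
theorem exists_isOpen_dimH_iInter_le {Y : Type*} [MetricSpace Y] (A : Set Y) :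
    ∃ O : ℕ → Set Y, (∀ m, IsOpen (O m)) ∧ A ⊆ ⋂ m, O m ∧ dimH (⋂ m, O m) ≤ dimH A := by
  borelize Y
  by_cases hA : dimH A = ⊤
  · exact ⟨fun _ => univ, fun _ => isOpen_univ, by simp, hA ▸ le_top⟩
  lift dimH A to ℝ≥0 using hA with a ha
  have hlt : ∀ m : ℕ, dimH A < ((a + ((m : ℝ≥0) + 1)⁻¹ : ℝ≥0) : ℝ≥0∞) := fun m => by
    rw [← ha]
    exact_mod_cast lt_add_of_pos_right a (by positivity)
  choose O hO hAO hO0 using fun m : ℕ => exists_isOpen_hausdorffMeasure_iInter_eq_zero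
    (d := ((a + ((m : ℝ≥0) + 1)⁻¹ : ℝ≥0) : ℝ)) (by positivity)
    (hausdorffMeasure_of_dimH_lt (hlt m))
  refine ⟨fun k => O k.unpair.1 k.unpair.2, fun k => hO _ _,
    subset_iInter fun k => (hAO _).trans (iInter_subset _ _), ?_⟩
  have hle : ∀ m : ℕ, dimH (⋂ k : ℕ, O k.unpair.1 k.unpair.2) ≤
      ((a + ((m : ℝ≥0) + 1)⁻¹ : ℝ≥0) : ℝ≥0∞) := fun m => by
    refine (dimH_mono ?_).trans (dimH_le_of_hausdorffMeasure_ne_top (s := ⋂ i, O m i) ?_)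
    · refine subset_iInter fun i => (iInter_subset _ (Nat.pair m i)).trans ?_
      simp
    · rw [hO0]
      exact ENNReal.zero_ne_top
  have hinv : Tendsto (fun m : ℕ => ((m : ℝ≥0) + 1)⁻¹) atTop (𝓝 0) := by
    have := (tendsto_inv_atTop_nhds_zero_nat (𝕜 := ℝ≥0)).comp (tendsto_add_atTop_nat 1)
    simpa [Function.comp_def] using this
  have hlim : Tendsto (fun m : ℕ => ((a + ((m : ℝ≥0) + 1)⁻¹ : ℝ≥0) : ℝ≥0∞)) atTop (𝓝 a) := by
    rw [ENNReal.tendsto_coe]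
    simpa using tendsto_const_nhds.add hinv
  exact ge_of_tendsto' hlim hle

/-- If `Y` embeds bi-Lipschitzly into `X × ℝⁿ` then `Y` has a countable base for which the set of
points on at least `n` boundaries is no larger than `X` in the sense of Hausdorff dimension. -/
theorem exists_base_dimH_frontiers_le {X Y : Type*} [MetricSpace X] [MetricSpace Y]
    [SeparableSpace Y] [Nonempty Y] {n : ℕ} (hn : 0 < n) {p : Y → X} {c : Y → Fin n → ℝ} {K : ℝ≥0}
    (hp : LipschitzWith 1 p) (hc : LipschitzWith 1 c)
    (hK : ∀ y y', dist y y' ≤ dist (p y) (p y') + K * dist (c y) (c y')) :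
    ∃ U : ℕ → Set Y, (∀ i, IsOpen (U i)) ∧
      (∀ y O, IsOpen O → y ∈ O → ∃ i, y ∈ U i ∧ U i ⊆ O) ∧
      dimH {y | ∃ s : Finset ℕ, s.card = n ∧ ∀ i ∈ s, y ∈ frontier (U i)} ≤
        dimH (univ : Set X) := by
  classical
  obtain ⟨L, hL, hLn⟩ := exists_linearMaps_general_position n
  let q : ℕ → Y := fun i => denseSeq Y i.unpair.1
  let r : ℕ → ℝ := fun i => 1 / ((i.unpair.2 : ℝ) + 1)
  let σ : Bool → ℝ := fun b => if b then 1 else -1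
  let f : ℕ → Fin n × Bool → Y → ℝ := fun i kb y =>
    σ kb.2 * L i kb.1 (c y - c (q i)) + dist (p y) (p (q i))
  have hf : ∀ i kb, Continuous (f i kb) := fun i kb =>
    (continuous_const.mul ((LinearMap.continuous_of_finiteDimensional _).comp
      (hc.continuous.sub continuous_const))).add (hp.continuous.dist continuous_const)
  let U : ℕ → Set Y := fun i => ⋂ kb, {y | f i kb y < r i}
  have hU : ∀ i, IsOpen (U i) := fun i =>
    isOpen_iInter_of_finite fun kb => isOpen_lt (hf i kb) continuous_const
  have hdp : ∀ y y', dist (p y) (p y') ≤ dist y y' := fun y y' => by simpa using hp.dist_le_mul y y'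
  have hdc : ∀ y y', ‖c y - c y'‖ ≤ dist y y' := fun y y' => by
    simpa [dist_eq_norm] using hc.dist_le_mul y y'
  refine ⟨U, hU, fun y O hO hy => ?_, ?_⟩
  · obtain ⟨ε, hε, hεO⟩ := Metric.isOpen_iff.1 hO y hy
    obtain ⟨m, hm⟩ := exists_nat_one_div_lt (show 0 < ε / (2 * K + 2) by positivity)
    have hr0 : (0 : ℝ) < 1 / (m + 1) := Nat.one_div_pos_of_nat
    obtain ⟨j, hj⟩ := (denseRange_denseSeq Y).exists_dist_lt y
      (show (0 : ℝ) < 1 / (m + 1) / 3 by positivity)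
    have hq : q (Nat.pair j m) = denseSeq Y j := by simp [q]
    have hr : r (Nat.pair j m) = 1 / (m + 1) := by simp [r]
    rw [← hq] at hj
    rw [← hr] at hm hr0 hj
    generalize Nat.pair j m = i at hm hr0 hj
    refine ⟨i, mem_iInter.2 fun ⟨k, b⟩ => ?_, fun y' hy' => hεO ?_⟩
    · have h1 := abs_le.1 (hL i k (c y - c (q i)))
      have h2 := abs_le.1 (norm_le_pi_norm (c y - c (q i)) k)
      have h3 := hdc y (q i)
      have h4 := hdp y (q i)
      show f i (k, b) y < r i
      cases b <;> simp only [f, σ, if_true, Bool.false_eq_true, if_false] <;> linarith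
    · have hy'' : ∀ k b, f i (k, b) y' < r i := fun k b => mem_iInter.1 hy' (k, b)
      simp only [f] at hy''
      have hd : dist (p y') (p (q i)) < r i := by
        have h1 := hy'' ⟨0, hn⟩ true
        have h2 := hy'' ⟨0, hn⟩ false
        simp only [σ, if_true, Bool.false_eq_true, if_false] at h1 h2
        linarith
      have hz : ‖c y' - c (q i)‖ ≤ r i + ‖c y' - c (q i)‖ / 2 := by
        refine (pi_norm_le_iff_of_nonneg (by positivity)).2 fun k => ?_
        have h0 := abs_le.1 (hL i k (c y' - c (q i)))
        have h1 := hy'' k true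
        have h2 := hy'' k false
        have h3 : 0 ≤ dist (p y') (p (q i)) := dist_nonneg
        simp only [σ, if_true, Bool.false_eq_true, if_false] at h1 h2
        refine abs_le.2 ⟨?_, ?_⟩ <;> linarith
      have h5 := hK y' (q i)
      rw [dist_eq_norm (c y')] at h5
      have h6 : K * ‖c y' - c (q i)‖ ≤ K * (2 * r i) :=
        mul_le_mul_of_nonneg_left (by linarith) K.2
      rw [lt_div_iff₀ (by positivity)] at hm
      rw [mem_ball]
      have h7 := dist_triangle_right y' y (q i)
      linarith
  · let E : (s : Finset ℕ) → (s → Fin n × Bool) → Set Y := fun s kb =>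
      {y | s.card = n ∧ ∀ i : s, f i (kb i) y = r i}
    have hE : {y | ∃ s : Finset ℕ, s.card = n ∧ ∀ i ∈ s, y ∈ frontier (U i)} ⊆
        ⋃ s, ⋃ kb, E s kb := by
      rintro y ⟨s, hs, hy⟩
      have : ∀ i : s, ∃ kb, f i kb y = r i := by
        intro i
        have hyi := hy i i.2
        rw [(hU i).frontier_eq] at hyi
        obtain ⟨kb, hkb⟩ : ∃ kb, ¬ f i kb y < r i := by
          simpa only [U, mem_iInter, not_forall, mem_ofPred_eq] using hyi.2
        refine ⟨kb, le_antisymm ?_ (not_lt.1 hkb)⟩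
        exact closure_lt_subset_le (hf i kb) continuous_const
          (closure_mono (iInter_subset _ kb) hyi.1)
      choose kb hkb using this
      exact mem_iUnion₂.2 ⟨s, kb, hs, hkb⟩
    refine (dimH_mono hE).trans ?_
    rw [dimH_iUnion]
    refine iSup_le fun s => ?_
    rw [dimH_iUnion]
    refine iSup_le fun kb => ?_
    by_cases hs : s.card = n
    swap
    · simp [E, hs]
    let Φ : (Fin n → ℝ) →ₗ[ℝ] (s → ℝ) := LinearMap.pi fun i => L i (kb i).1
    have hker : LinearMap.ker Φ = ⊥ := by
      refine LinearMap.ker_eq_bot'.2 fun z hz => ?_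
      refine hLn s hs (fun i => if h : i ∈ s then (kb ⟨i, h⟩).1 else ⟨0, hn⟩) z fun i hi => ?_
      rw [dif_pos hi]
      exact congrFun hz ⟨i, hi⟩
    obtain ⟨M, -, hM⟩ := Φ.exists_antilipschitzWith hker
    have hanti : AntilipschitzWith (1 + K * M) fun y : E s kb => p y := by
      refine AntilipschitzWith.of_le_mul_dist fun y y' => ?_
      have h1 : dist (c y) (c y') ≤ M * dist (p y) (p y') := by
        refine (hM.le_mul_dist _ _).trans (mul_le_mul_of_nonneg_left ?_ M.2)
        refine (dist_pi_le_iff dist_nonneg).2 fun i => ?_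
        have e1 : f i (kb i) y = r i := y.2.2 i
        have e2 : f i (kb i) y' = r i := y'.2.2 i
        have e3 := abs_le.1 (abs_dist_sub_le (p y) (p y') (p (q i)))
        simp only [f, σ, map_sub] at e1 e2
        simp only [Φ, LinearMap.pi_apply, Real.dist_eq]
        cases h : (kb i).2 <;> simp only [h, if_true, Bool.false_eq_true, if_false] at e1 e2 <;>
          refine abs_le.2 ⟨?_, ?_⟩ <;> linarith
      have h2 := mul_le_mul_of_nonneg_left h1 K.2
      have h3 := hK y y'
      push_cast
      change dist (y : Y) y' ≤ _
      rw [add_mul, one_mul, mul_assoc]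
      exact h3.trans (add_le_add_right h2 _)
    calc dimH (E s kb) = dimH (univ : Set (E s kb)) := by
          rw [← (isometry_subtype_coe (s := E s kb)).dimH_image, image_univ, Subtype.range_coe]
      _ ≤ _ := hanti.le_dimH_image _
      _ ≤ _ := dimH_mono (subset_univ _)

theorem hdim_mono {X Y : Type*} [MetricSpace X] [MetricSpace Y] {A : Set X} {B : Set Y}
    (hB : B.Nonempty) (h : dimH A ≤ dimH B) : hdim A ≤ hdim B := by
  rw [hdim, hdim, if_neg hB.ne_empty]
  split_ifs
  · exact (by norm_num : (-1 : EReal) ≤ 0).trans (EReal.coe_ennreal_nonneg _)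
  · exact EReal.coe_ennreal_le_coe_ennreal_iff.2 h

theorem dStar_hdim_le {X Y : Type*} [MetricSpace X] [Nonempty X] [MetricSpace Y]
    [SeparableSpace Y] [Nonempty Y] {n : ℕ} (hn : 0 < n) {p : Y → X} {c : Y → Fin n → ℝ} {K : ℝ≥0}
    (hp : LipschitzWith 1 p) (hc : LipschitzWith 1 c)
    (hK : ∀ y y', dist y y' ≤ dist (p y) (p y') + K * dist (c y) (c y')) :
    dStar hdim n (univ : Set Y) ≤ hdim (univ : Set X) := by
  obtain ⟨U, hU, hbase, hUdim⟩ := exists_base_dimH_frontiers_le hn hp hc hK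
  obtain ⟨O, hO, hGO, hOdim⟩ := exists_isOpen_dimH_iInter_le
    {y | ∃ s : Finset ℕ, s.card = n ∧ ∀ i ∈ s, y ∈ frontier (U i)}
  have htdim : tdim (⋂ m, O m)ᶜ ≤ (n : EReal) - 1 := by
    rw [tdim, indDim_le_iff]
    refine indBelow_of_frontiers n (fun i => Subtype.val ⁻¹' U i)
      (fun i => (hU i).preimage continuous_subtype_val) ?_ ?_
    · rintro x W hW hx
      obtain ⟨V, hV, rfl⟩ := isOpen_induced_iff.1 hW
      obtain ⟨i, hi, hiV⟩ := hbase x V hV hx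
      exact ⟨i, hi, preimage_mono hiV⟩
    · intro x s hs
      by_contra! hns
      obtain ⟨t, hts, htn⟩ := Finset.exists_subset_card_eq hns
      refine x.2 (hGO ⟨t, htn, fun i hi => ?_⟩)
      exact continuous_subtype_val.frontier_preimage_subset (U i) (hs i (hts hi))
  have hFσ : IsFSigmaIn (⋂ m, O m)ᶜ univ :=
    ⟨fun m => (O m)ᶜ, fun m => (hO m).isClosed_compl, by simp [compl_iInter]⟩
  calc dStar hdim n univ ≤ hdim (univ \ (⋂ m, O m)ᶜ) := sInf_le ⟨_, hFσ, htdim, rfl⟩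
    _ = hdim (⋂ m, O m) := by rw [← compl_eq_univ_sdiff, compl_compl]
    _ ≤ hdim univ := hdim_mono univ_nonempty (hOdim.trans hUdim)

theorem le_dStar_hdim {X Y : Type*} [MetricSpace X] [Nonempty X] [MetricSpace Y] {n : ℕ}
    {p : Y → X} (hp : LipschitzWith 1 p)
    (e : X → (Fin n → unitInterval) → Y) (he : ∀ x, IsInducing (e x)) (hpe : ∀ x t, p (e x t) = x) :
    hdim (univ : Set X) ≤ dStar hdim n (univ : Set Y) := by
  refine le_sInf ?_
  rintro _ ⟨F, -, hF, rfl⟩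
  rw [tdim, indDim_le_iff] at hF
  have hsurj : p '' (univ \ F) = univ := by
    refine eq_univ_of_forall fun x => ?_
    by_contra hx
    have hxF : ∀ t, e x t ∈ F := fun t => by
      by_contra ht
      exact hx ⟨e x t, ⟨mem_univ _, ht⟩, hpe x t⟩
    exact not_indBelow_cube n (indBelow_of_isInducing n ((he x).codRestrict hxF) hF)
  refine hdim_mono ?_ ?_
  · rw [← image_nonempty (f := p), hsurj]
    exact univ_nonempty
  · rw [← hsurj]
    exact hp.dimH_image_le _

/-- `d^n_H(X × [0,1]ⁿ) = dim_H X`, with the `ℓ²` product metric. -/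
theorem stmt4 (X : Type*) [MetricSpace X] [TopologicalSpace.SeparableSpace X] [Nonempty X]
    (n : ℕ) (hn : 0 < n) :
    dStar hdim n (Set.univ :
        Set (WithLp 2 (X × {x : EuclideanSpace ℝ (Fin n) // ∀ i, x i ∈ Set.Icc (0:ℝ) 1}))) =
      hdim (Set.univ : Set X) := by
  let Q := {x : EuclideanSpace ℝ (Fin n) // ∀ i, x i ∈ Set.Icc (0:ℝ) 1}
  have : Nonempty (WithLp 2 (X × Q)) :=
    ‹Nonempty X›.elim fun x => ⟨WithLp.toLp 2 (x, ⟨0, fun i => by simp⟩)⟩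
  have hfst : LipschitzWith 1 fun y : WithLp 2 (X × Q) => y.fst :=
    LipschitzWith.of_dist_le_mul fun y y' => by simpa using WithLp.dist_fst_le y y'
  have hsnd : LipschitzWith 1 fun y : WithLp 2 (X × Q) => y.snd :=
    LipschitzWith.of_dist_le_mul fun y y' => by simpa using WithLp.dist_snd_le y y'
  have hcoord : LipschitzWith 1 fun y : WithLp 2 (X × Q) =>
      WithLp.ofLp (y.snd : EuclideanSpace ℝ (Fin n)) :=
    (PiLp.lipschitzWith_ofLp 2 fun _ : Fin n => ℝ).comp hsnd |>.weaken (mul_one _).le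
  obtain ⟨M, hM⟩ : ∃ M : ℝ≥0, AntilipschitzWith M (WithLp.ofLp : EuclideanSpace ℝ (Fin n) → _) :=
    ⟨_, PiLp.antilipschitzWith_ofLp 2 fun _ : Fin n => ℝ⟩
  refine le_antisymm (dStar_hdim_le hn (K := M) hfst hcoord fun y y' => ?_) ?_
  · have h1 := hM.le_mul_dist
      (y.snd : EuclideanSpace ℝ (Fin n)) (y'.snd : EuclideanSpace ℝ (Fin n))
    have h2 : dist y y' ≤ dist y.fst y'.fst + dist y.snd y'.snd := by
      have := WithLp.prod_dist_eq_add (p := 2) (by norm_num) y y'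
      exact this.trans_le (Real.rpow_add_rpow_le_add dist_nonneg dist_nonneg (by norm_num))
    exact h2.trans (add_le_add_right h1 _)
  · have hmem : ∀ (t : Fin n → unitInterval) (i : Fin n),
        (WithLp.toLp 2 fun j => (t j : ℝ) : EuclideanSpace ℝ (Fin n)) i ∈ Set.Icc (0 : ℝ) 1 :=
      fun t i => (t i).2
    refine le_dStar_hdim hfst (fun x t => WithLp.toLp 2 (x, ⟨_, hmem t⟩)) (fun x => ?_)
      fun _ _ => rfl
    have hcont : Continuous fun t : Fin n → unitInterval =>
        (WithLp.toLp 2 (x, ⟨_, hmem t⟩) : WithLp 2 (X × Q)) := by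
      fun_prop
    refine IsInducing.of_comp hcont hcoord.continuous ?_
    exact IsInducing.piMap fun _ => IsInducing.subtypeVal
end

section
/- Let n be a positive integer and let dim_* be one of dim_T, dim_H, dim_P. If X is a separable metric space and X = ∪_{i≥1} X_i where each X_i is an F_σ subset of X, then d^n_*(X) = sup_{i≥1} d^n_*(X_i). -/
open Set Metric Filter Topology TopologicalSpace
open scoped ENNReal NNReal

section IndBelow

variable {Y Z : Type*}

theorem indBelow_of_isEmbedding [TopologicalSpace Y] [TopologicalSpace Z] {f : Y → Z}
    (hf : IsEmbedding f) {n : ℕ} (h : indBelow n Z) : indBelow n Y := by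
  induction n generalizing Y Z with
  | zero =>
    have : IsEmpty Z := h
    exact Function.isEmpty f
  | succ n ih =>
    intro y U hU hy
    obtain ⟨W, hW, rfl⟩ := hf.isOpen_iff.1 hU
    obtain ⟨V, hV, hyV, hVW, hfr⟩ := h (f y) W hW hy
    refine ⟨f ⁻¹' V, hV.preimage hf.continuous, hyV, preimage_mono hVW, ?_⟩
    have hsub : MapsTo f (frontier (f ⁻¹' V)) (frontier V) :=
      hf.continuous.frontier_preimage_subset V
    exact ih (f := hsub.restrict) (hf.restrict hsub) hfr

theorem indBelow_mono_set [TopologicalSpace Y] {n : ℕ} {A B : Set Y} (hAB : A ⊆ B)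
    (h : indBelow n B) : indBelow n A :=
  indBelow_of_isEmbedding (IsEmbedding.inclusion hAB) h

theorem indBelow_succ [TopologicalSpace Y] {n : ℕ} (h : indBelow n Y) : indBelow (n + 1) Y := by
  induction n generalizing Y with
  | zero =>
    have : IsEmpty Y := h
    exact fun x => isEmptyElim x
  | succ n ih =>
    intro x U hU hx
    obtain ⟨V, hV, hxV, hVU, hfr⟩ := h x U hU hx
    exact ⟨V, hV, hxV, hVU, ih hfr⟩

theorem indBelow_mono_s6 [TopologicalSpace Y] {m n : ℕ} (hmn : m ≤ n) (h : indBelow m Y) :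
    indBelow n Y := by
  induction hmn with
  | refl => exact h
  | step _ ih => exact indBelow_succ ih

theorem indBelow_one_iff [TopologicalSpace Y] :
    indBelow 1 Y ↔ ∀ (x : Y) (U : Set Y), IsOpen U → x ∈ U →
      ∃ V : Set Y, IsClopen V ∧ x ∈ V ∧ V ⊆ U := by
  change (∀ (x : Y) (U : Set Y), IsOpen U → x ∈ U →
    ∃ V : Set Y, IsOpen V ∧ x ∈ V ∧ V ⊆ U ∧ IsEmpty ↥(frontier V)) ↔ _
  refine forall₄_congr fun x U hU hx => ⟨?_, ?_⟩
  · rintro ⟨V, hV, hxV, hVU, hfr⟩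
    exact ⟨V, isClopen_iff_frontier_eq_empty.2 (isEmpty_coe_sort.1 hfr), hxV, hVU⟩
  · rintro ⟨V, hV, hxV, hVU⟩
    exact ⟨V, hV.isOpen, hxV, hVU, isEmpty_coe_sort.2 hV.frontier_eq⟩

/-- In a second countable zero-dimensional space, disjoint closed sets are separated by a
clopen set. -/
theorem exists_isClopen_of_indBelow_one [TopologicalSpace Y] [SecondCountableTopology Y]
    (h : indBelow 1 Y) {A B : Set Y} (hA : IsClosed A) (hB : IsClosed B) (hAB : Disjoint A B) :
    ∃ C : Set Y, IsClopen C ∧ A ⊆ C ∧ Disjoint C B := by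
  rcases isEmpty_or_nonempty Y with hY | hY
  · exact ⟨∅, isClopen_empty, fun x => isEmptyElim x, empty_disjoint _⟩
  have hW : ∀ x : Y, ∃ W : Set Y, IsClopen W ∧ x ∈ W ∧ (Disjoint W A ∨ Disjoint W B) := by
    intro x
    by_cases hx : x ∈ A
    · obtain ⟨W, hW, hxW, hWB⟩ := indBelow_one_iff.1 h x Bᶜ hB.isOpen_compl
        (disjoint_left.1 hAB hx)
      exact ⟨W, hW, hxW, .inr (subset_compl_iff_disjoint_right.1 hWB)⟩
    · obtain ⟨W, hW, hxW, hWA⟩ := indBelow_one_iff.1 h x Aᶜ hA.isOpen_compl hx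
      exact ⟨W, hW, hxW, .inl (subset_compl_iff_disjoint_right.1 hWA)⟩
  choose W hWc hxW hWd using hW
  obtain ⟨s, hs, hcov⟩ := TopologicalSpace.countable_cover_nhds fun x =>
    (hWc x).isOpen.mem_nhds (hxW x)
  have hne : s.Nonempty := by
    obtain ⟨x⟩ := hY
    have hx := hcov.ge (mem_univ x)
    simp only [mem_iUnion] at hx
    obtain ⟨y, hy, -⟩ := hx
    exact ⟨y, hy⟩
  obtain ⟨e, rfl⟩ := hs.exists_eq_range hne
  rw [biUnion_range] at hcov
  set G : ℕ → Set Y := disjointed fun i => W (e i) with hG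
  have hGc : ∀ i, IsClopen (G i) := fun i =>
    disjointedRec (fun _ _ hp => hp.diff (hWc _)) (hWc _)
  have hGcov : ⋃ i, G i = univ := by rw [hG, iUnion_disjointed, hcov]
  have hGd : ∀ i, Disjoint (G i) A ∨ Disjoint (G i) B := fun i =>
    (hWd (e i)).imp (fun h => h.mono_left (disjointed_subset _ i))
      (fun h => h.mono_left (disjointed_subset _ i))
  have hcompl : (⋃ (i) (_ : Disjoint (G i) B), G i)ᶜ = ⋃ (i) (_ : ¬Disjoint (G i) B), G i := by
    ext x
    obtain ⟨i, hi⟩ := mem_iUnion.1 (hGcov.ge (mem_univ x))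
    have huniq : ∀ j, x ∈ G j → j = i := fun j hj => by
      by_contra hne
      exact disjoint_left.1 (disjoint_disjointed _ hne) hj hi
    simp only [mem_compl_iff, mem_iUnion, exists_prop]
    constructor
    · intro hx
      exact ⟨i, fun hd => hx ⟨i, hd, hi⟩, hi⟩
    · rintro ⟨j, hj, hxj⟩ ⟨k, hk, hxk⟩
      rw [huniq j hxj] at hj
      rw [huniq k hxk] at hk
      exact hj hk
  refine ⟨⋃ (i) (_ : Disjoint (G i) B), G i, ⟨?_, ?_⟩, ?_, ?_⟩
  · rw [← isOpen_compl_iff, hcompl]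
    exact isOpen_iUnion fun i => isOpen_iUnion fun _ => (hGc i).isOpen
  · exact isOpen_iUnion fun i => isOpen_iUnion fun _ => (hGc i).isOpen
  · intro x hx
    obtain ⟨i, hi⟩ := mem_iUnion.1 (hGcov.ge (mem_univ x))
    exact mem_iUnion₂.2 ⟨i, (hGd i).resolve_left fun hd => disjoint_left.1 hd hi hx, hi⟩
  · simp only [disjoint_iUnion_left]
    exact fun i hi => hi

/-- A zero-dimensional subspace can be avoided by the frontiers of small neighbourhoods. -/
theorem exists_isOpen_disjoint_frontier [TopologicalSpace Y] [T5Space Y]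
    [SecondCountableTopology Y] {S : Set Y} (hS : indBelow 1 S) {x : Y} {U : Set Y}
    (hU : IsOpen U) (hx : x ∈ U) :
    ∃ V : Set Y, IsOpen V ∧ x ∈ V ∧ V ⊆ U ∧ Disjoint (frontier V) S := by
  obtain ⟨V₂, hV₂, hxV₂, hV₂U⟩ := normal_exists_closure_subset (isClosed_singleton (x := x)) hU
    (singleton_subset_iff.2 hx)
  obtain ⟨V₁, hV₁, hxV₁, hV₁V₂⟩ := normal_exists_closure_subset (isClosed_singleton (x := x)) hV₂
    hxV₂
  rw [singleton_subset_iff] at hxV₁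
  obtain ⟨C, hC, hAC, hCB⟩ := exists_isClopen_of_indBelow_one hS
    (isClosed_closure.preimage continuous_subtype_val : IsClosed ((↑) ⁻¹' closure V₁ : Set S))
    (hV₂.isClosed_compl.preimage continuous_subtype_val)
    (disjoint_left.2 fun z hz hz' => hz' (hV₁V₂ hz))
  have hCV₂ : ((↑) '' C : Set Y) ⊆ V₂ := by
    rintro _ ⟨z, hz, rfl⟩
    by_contra hzV
    exact disjoint_left.1 hCB hz hzV
  obtain ⟨O, hO, hOC⟩ := isOpen_induced_iff.1 hC.isOpen
  obtain ⟨O', hO', hOC'⟩ := isOpen_induced_iff.1 hC.compl.isOpen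
  have key : SeparatedNhds (insert x ((↑) '' C : Set Y)) (Uᶜ ∪ (↑) '' Cᶜ) := by
    rw [separatedNhds_iff_disjoint]
    apply completely_normal
    · have h1 : closure (insert x ((↑) '' C : Set Y)) ⊆ closure V₂ :=
        closure_mono (insert_subset (hxV₂ rfl) hCV₂)
      rw [disjoint_union_right]
      refine ⟨disjoint_compl_right_iff_subset.2 (h1.trans hV₂U), ?_⟩
      rw [disjoint_right]
      rintro _ ⟨z, hz, rfl⟩ hzc
      have hzO : (z : Y) ∈ O' ∩ (closure V₁)ᶜ :=
        ⟨by rw [← hOC'] at hz; exact hz, fun hz' => hz (hAC hz')⟩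
      obtain ⟨w, ⟨hwO, hwV⟩, hw⟩ := mem_closure_iff.1 hzc _
        (hO'.inter isClosed_closure.isOpen_compl) hzO
      rcases hw with rfl | ⟨w, hw, rfl⟩
      · exact hwV (subset_closure hxV₁)
      · have : w ∈ Cᶜ := by rw [← hOC']; exact hwO
        exact this hw
    · rw [disjoint_right]
      intro z hz hzC
      rw [closure_union, hU.isClosed_compl.closure_eq] at hz
      rcases hz with hz | hz
      · rcases hzC with rfl | hzC
        · exact hz hx
        · exact hz (hV₂U (subset_closure (hCV₂ hzC)))
      · rcases hzC with rfl | ⟨z, hzC, rfl⟩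
        · obtain ⟨_, hwV, w, hw, rfl⟩ := mem_closure_iff.1 hz _ hV₁ hxV₁
          exact hw (hAC (subset_closure hwV : (w : Y) ∈ closure V₁))
        · have hzO : (z : Y) ∈ O := by rw [← hOC] at hzC; exact hzC
          obtain ⟨_, hwO, w, hw, rfl⟩ := mem_closure_iff.1 hz _ hO hzO
          have : w ∈ C := by rw [← hOC]; exact hwO
          exact hw this
  obtain ⟨V, W, hV, hW, hAV, hBW, hVW⟩ := key
  refine ⟨V, hV, hAV (mem_insert _ _), fun z hz => ?_, disjoint_right.2 fun z hz hzf => ?_⟩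
  · by_contra hzU
    exact disjoint_left.1 hVW hz (hBW (.inl hzU))
  · by_cases hzC : (⟨z, hz⟩ : S) ∈ C
    · rw [hV.frontier_eq] at hzf
      exact hzf.2 (hAV (.inr ⟨_, hzC, rfl⟩))
    · obtain ⟨w, hwW, hwV⟩ := mem_closure_iff.1 hzf.1 W hW (hBW (.inr ⟨_, hzC, rfl⟩))
      exact disjoint_left.1 hVW hwV hwW

/-- The countable closed sum theorem in dimension zero. -/
theorem indBelow_one_of_isClosed_cover [TopologicalSpace Y] [T4Space Y]
    [SecondCountableTopology Y] (F : ℕ → Set Y) (hF : ∀ i, IsClosed (F i))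
    (hcov : ⋃ i, F i = univ) (h : ∀ i, indBelow 1 (F i)) : indBelow 1 Y := by
  let P := {p : Set Y × Set Y // IsClosed p.1 ∧ IsClosed p.2 ∧ Disjoint p.1 p.2}
  have step : ∀ (i : ℕ) (p : P), ∃ q : P, p.1.1 ⊆ interior q.1.1 ∧ p.1.2 ⊆ interior q.1.2 ∧
      F i ⊆ interior q.1.1 ∪ interior q.1.2 := by
    rintro i ⟨⟨A, B⟩, hA, hB, hAB⟩
    dsimp only at hA hB hAB ⊢
    obtain ⟨C, hC, hAC, hCB⟩ := exists_isClopen_of_indBelow_one (h i)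
      (hA.preimage continuous_subtype_val) (hB.preimage continuous_subtype_val)
      (hAB.preimage _)
    have hd : Disjoint (A ∪ (↑) '' C) (B ∪ (↑) '' Cᶜ) := by
      rw [disjoint_left]
      rintro z (hz | ⟨z, hz, rfl⟩) (hz' | ⟨w, hw, hwz⟩)
      · exact disjoint_left.1 hAB hz hz'
      · subst hwz
        exact hw (hAC hz)
      · exact disjoint_left.1 hCB hz hz'
      · exact hw (Subtype.val_injective hwz ▸ hz)
    have hA' : IsClosed (A ∪ (↑) '' C) :=
      hA.union ((hF i).isClosedEmbedding_subtypeVal.isClosedMap _ hC.isClosed)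
    have hB' : IsClosed (B ∪ (↑) '' Cᶜ) :=
      hB.union ((hF i).isClosedEmbedding_subtypeVal.isClosedMap _ hC.compl.isClosed)
    obtain ⟨U, V, hU, hV, hAU, hBV, hUV⟩ := normal_separation hA' hB' hd
    obtain ⟨U', hU', hAU', hUU'⟩ := normal_exists_closure_subset hA' hU hAU
    obtain ⟨V', hV', hBV', hVV'⟩ := normal_exists_closure_subset hB' hV hBV
    have hiU := interior_maximal (subset_closure (s := U')) hU'
    have hiV := interior_maximal (subset_closure (s := V')) hV'
    refine ⟨⟨⟨closure U', closure V'⟩, isClosed_closure, isClosed_closure,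
      hUV.mono hUU' hVV'⟩, ?_, ?_, ?_⟩
    · exact (subset_union_left.trans hAU').trans hiU
    · exact (subset_union_left.trans hBV').trans hiV
    · intro z hz
      by_cases hzC : (⟨z, hz⟩ : F i) ∈ C
      · exact .inl (hiU (hAU' (.inr ⟨_, hzC, rfl⟩)))
      · exact .inr (hiV (hBV' (.inr ⟨_, hzC, rfl⟩)))
  choose q hq₁ hq₂ hqF using step
  rw [indBelow_one_iff]
  intro x U hU hx
  let p : ℕ → P := fun k => Nat.rec
    ⟨⟨{x}, Uᶜ⟩, isClosed_singleton, hU.isClosed_compl,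
      disjoint_left.2 (by rintro _ rfl h; exact h hx)⟩
    (fun i r => q i r) k
  have hsucc : ∀ i, p (i + 1) = q i (p i) := fun i => rfl
  have hm₁ : Monotone fun i => (p i).1.1 := monotone_nat_of_le_succ fun i => by
    rw [hsucc]; exact (hq₁ i _).trans interior_subset
  have hm₂ : Monotone fun i => (p i).1.2 := monotone_nat_of_le_succ fun i => by
    rw [hsucc]; exact (hq₂ i _).trans interior_subset
  have hdis : Disjoint (⋃ i, interior (p i).1.1) (⋃ i, interior (p i).1.2) := by
    simp only [disjoint_iUnion_left, disjoint_iUnion_right]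
    intro i j
    exact (p (max i j)).2.2.2.mono (interior_subset.trans (hm₁ (le_max_right _ _)))
      (interior_subset.trans (hm₂ (le_max_left _ _)))
  have hun : (⋃ i, interior (p i).1.1)ᶜ = ⋃ i, interior (p i).1.2 := by
    refine subset_antisymm (fun z hz => ?_) (subset_compl_iff_disjoint_left.2 hdis)
    obtain ⟨i, hi⟩ := mem_iUnion.1 (hcov.ge (mem_univ z))
    rcases hqF i (p i) hi with h | h
    · exact absurd (mem_iUnion.2 ⟨i + 1, h⟩) hz
    · exact mem_iUnion.2 ⟨i + 1, h⟩
  refine ⟨⋃ i, interior (p i).1.1, ⟨?_, isOpen_iUnion fun _ => isOpen_interior⟩, ?_, ?_⟩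
  · rw [← isOpen_compl_iff, hun]
    exact isOpen_iUnion fun _ => isOpen_interior
  · exact mem_iUnion.2 ⟨1, hq₁ 0 (p 0) rfl⟩
  · intro z hz
    by_contra hzU
    exact disjoint_left.1 hdis hz (mem_iUnion.2 ⟨1, hq₂ 0 (p 0) hzU⟩)

/-- `A` is covered by `n` zero-dimensional subspaces. -/
def CoveredByZeroDim [TopologicalSpace Y] (n : ℕ) (A : Set Y) : Prop :=
  ∃ S : Fin n → Set Y, A ⊆ ⋃ i, S i ∧ ∀ i, indBelow 1 (S i)

theorem indBelow_one_of_closed_cover_set [TopologicalSpace Y] [T5Space Y]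
    [SecondCountableTopology Y] {ι : Type*} [Countable ι] {A : Set Y} (C : ι → Set Y)
    (hC : ∀ i, IsClosed (C i)) (hcov : A ⊆ ⋃ i, C i) (h : ∀ i, indBelow 1 ↥(A ∩ C i)) :
    indBelow 1 A := by
  rcases isEmpty_or_nonempty ι with hι | hι
  · have : IsEmpty A := by
      rw [isEmpty_coe_sort, ← subset_empty_iff]
      simpa using hcov
    exact indBelow_succ (n := 0) this
  obtain ⟨e, he⟩ := exists_surjective_nat ι
  refine indBelow_one_of_isClosed_cover (fun k => ((↑) ⁻¹' C (e k) : Set A))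
    (fun k => (hC _).preimage continuous_subtype_val) ?_ fun k => ?_
  · refine eq_univ_of_forall fun x => ?_
    obtain ⟨i, hi⟩ := mem_iUnion.1 (hcov x.2)
    obtain ⟨k, rfl⟩ := he i
    exact mem_iUnion.2 ⟨k, hi⟩
  · have hm : MapsTo ((↑) : A → Y) ((↑) ⁻¹' C (e k)) (A ∩ C (e k)) := fun x hx => ⟨x.2, hx⟩
    exact indBelow_of_isEmbedding (IsEmbedding.subtypeVal.restrict hm) (h (e k))

theorem exists_isClosed_iUnion_eq_disjointed {Y : Type*} [MetricSpace Y] {C : ℕ → Set Y}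
    (hC : ∀ i, IsClosed (C i)) (i : ℕ) :
    ∃ E : ℕ → Set Y, (∀ m, IsClosed (E m)) ∧ ⋃ m, E m = disjointed C i := by
  have hopen : IsOpen (⋂ j < i, (C j)ᶜ) :=
    (finite_lt_nat i).isOpen_biInter fun j _ => (hC j).isOpen_compl
  obtain ⟨G, hG, -, hGU, -⟩ := hopen.exists_iUnion_isClosed
  refine ⟨fun m => C i ∩ G m, fun m => (hC i).inter (hG m), ?_⟩
  rw [← inter_iUnion, hGU, disjointed_eq_inter_compl]

theorem CoveredByZeroDim.of_closed_cover {Y : Type*} [MetricSpace Y]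
    [SecondCountableTopology Y] {n : ℕ} {A : Set Y} (C : ℕ → Set Y)
    (hC : ∀ i, IsClosed (C i)) (hcov : A ⊆ ⋃ i, C i)
    (h : ∀ i, CoveredByZeroDim n (A ∩ C i)) : CoveredByZeroDim n A := by
  choose S hS hS1 using h
  choose E hE hEC using exists_isClosed_iUnion_eq_disjointed hC
  refine ⟨fun j => ⋃ i, S i j ∩ disjointed C i, fun x hx => ?_, fun j => ?_⟩
  · have hx' := hcov hx
    rw [← iUnion_disjointed] at hx'
    obtain ⟨i, hi⟩ := mem_iUnion.1 hx'
    obtain ⟨j, hj⟩ := mem_iUnion.1 (hS i ⟨hx, disjointed_subset _ _ hi⟩)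
    exact mem_iUnion.2 ⟨j, mem_iUnion.2 ⟨i, hj, hi⟩⟩
  · refine indBelow_one_of_closed_cover_set (fun p : ℕ × ℕ => E p.1 p.2) (fun p => hE _ _) ?_ ?_
    · intro x hx
      obtain ⟨i, -, hi⟩ := mem_iUnion.1 hx
      rw [← hEC] at hi
      obtain ⟨m, hm⟩ := mem_iUnion.1 hi
      exact mem_iUnion.2 ⟨(i, m), hm⟩
    · rintro ⟨i, m⟩
      refine indBelow_mono_set ?_ (hS1 i j)
      rintro x ⟨hx, hxE⟩
      obtain ⟨k, hk, hxk⟩ := mem_iUnion.1 hx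
      have hxi : x ∈ disjointed C i := by
        rw [← hEC]; exact mem_iUnion.2 ⟨m, hxE⟩
      have hki : k = i := by
        by_contra hne
        exact disjoint_left.1 (disjoint_disjointed C hne) hxk hxi
      exact hki ▸ hk

theorem indBelow_of_coveredByZeroDim {Y : Type*} [MetricSpace Y] [SecondCountableTopology Y]
    {n : ℕ} {A : Set Y} (h : CoveredByZeroDim n A) : indBelow n A := by
  induction n generalizing A with
  | zero =>
    obtain ⟨S, hS, -⟩ := h
    refine isEmpty_coe_sort.2 (subset_empty_iff.1 ?_)
    simpa using hS
  | succ n ih =>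
    obtain ⟨S, hS, hS1⟩ := h
    intro x U hU hx
    have h0 : indBelow 1 ↥((↑) ⁻¹' S 0 : Set A) :=
      indBelow_of_isEmbedding
        (IsEmbedding.subtypeVal.restrict (mapsTo_preimage ((↑) : A → Y) (S 0))) (hS1 0)
    obtain ⟨V, hV, hxV, hVU, hfr⟩ := exists_isOpen_disjoint_frontier h0 hU hx
    refine ⟨V, hV, hxV, hVU, ?_⟩
    have hz : CoveredByZeroDim n ((↑) '' frontier V : Set Y) := by
      refine ⟨fun i => S i.succ, ?_, fun i => hS1 _⟩
      rintro _ ⟨z, hz, rfl⟩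
      obtain ⟨i, hi⟩ := mem_iUnion.1 (hS z.2)
      rcases Fin.eq_zero_or_eq_succ i with rfl | ⟨j, rfl⟩
      · exact absurd hi (disjoint_left.1 hfr hz)
      · exact mem_iUnion.2 ⟨j, hi⟩
    exact indBelow_of_isEmbedding
      (IsEmbedding.subtypeVal.restrict (mapsTo_image ((↑) : A → Y) (frontier V))) (ih hz)

theorem coveredByZeroDim_of_indBelow {Y : Type*} [MetricSpace Y] [SecondCountableTopology Y]
    {n : ℕ} {A : Set Y} (h : indBelow n A) : CoveredByZeroDim n A := by
  induction n generalizing A with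
  | zero =>
    have : A = ∅ := isEmpty_coe_sort.1 h
    exact ⟨fun _ => ∅, by simp [this], fun i => i.elim0⟩
  | succ n ih =>
    have hbasis : IsTopologicalBasis {V : Set A | IsOpen V ∧ indBelow n ↥(frontier V)} :=
      isTopologicalBasis_of_isOpen_of_nhds (fun V hV => hV.1) fun x U hx hU => by
        obtain ⟨V, hV, hxV, hVU, hfr⟩ := h x U hU hx
        exact ⟨V, ⟨hV, hfr⟩, hxV, hVU⟩
    obtain ⟨s, hsub, hsc, hs⟩ := hbasis.exists_countable
    have hK : ∀ V ∈ s, CoveredByZeroDim n ((↑) '' frontier V : Set Y) := fun V hV =>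
      ih (indBelow_of_isEmbedding (f := (IsEmbedding.subtypeVal.homeomorphImage
        (frontier V)).symm) (Homeomorph.isEmbedding _) (hsub hV).2)
    set T : Set Y := ⋃ V ∈ s, (↑) '' frontier V with hT
    have hTc : CoveredByZeroDim n T := by
      have hcl : ∀ V : Set A, ∃ C : Set Y, IsClosed C ∧ (↑) ⁻¹' C = frontier V := fun V =>
        isClosed_induced_iff.1 isClosed_frontier
      choose C hC hCf using hcl
      rcases s.eq_empty_or_nonempty with rfl | hne
      · exact ⟨fun _ => ∅, by simp [hT], fun i => indBelow_succ (n := 0) (isEmpty_coe_sort.2 rfl)⟩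
      obtain ⟨e, rfl⟩ := hsc.exists_eq_range hne
      refine CoveredByZeroDim.of_closed_cover (fun i => C (e i)) (fun i => hC _) ?_ fun i => ?_
      · simp only [hT, iUnion_subset_iff]
        rintro _ ⟨i, rfl⟩ _ ⟨z, hz, rfl⟩
        rw [← hCf] at hz
        exact mem_iUnion.2 ⟨i, hz⟩
      · obtain ⟨S, hS, hS1⟩ := hK (e i) ⟨i, rfl⟩
        refine ⟨S, fun x hx => hS ?_, hS1⟩
        have hxA : x ∈ A := by
          obtain ⟨V, -, z, -, rfl⟩ := mem_iUnion₂.1 hx.1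
          exact z.2
        refine ⟨⟨x, hxA⟩, ?_, rfl⟩
        rw [← hCf]
        exact hx.2
    obtain ⟨S, hS, hS1⟩ := hTc
    refine ⟨Fin.cons (A \ T) S, fun x hx => ?_, Fin.cases ?_ hS1⟩
    · by_cases hxT : x ∈ T
      · obtain ⟨i, hi⟩ := mem_iUnion.1 (hS hxT)
        exact mem_iUnion.2 ⟨i.succ, hi⟩
      · exact mem_iUnion.2 ⟨0, hx, hxT⟩
    · change indBelow 1 ↥(A \ T)
      rw [indBelow_one_iff]
      intro x U hU hx
      obtain ⟨O, hO, rfl⟩ := isOpen_induced_iff.1 hU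
      let f : ↥(A \ T) → A := inclusion sdiff_subset
      have hf : Continuous f := continuous_inclusion sdiff_subset
      obtain ⟨V, hVs, hxV, hVO⟩ := hs.exists_subset_of_mem_open (a := f x)
        (u := (↑) ⁻¹' O) hx (hO.preimage continuous_subtype_val)
      refine ⟨f ⁻¹' V, ?_, hxV, preimage_mono (f := f) hVO⟩
      rw [isClopen_iff_frontier_eq_empty, ← subset_empty_iff]
      refine (hf.frontier_preimage_subset V).trans fun z hz => ?_
      exact z.2.2 (mem_iUnion₂.2 ⟨V, hVs, f z, hz, rfl⟩)

/-- The countable closed sum theorem for the small inductive dimension of subspaces of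
a separable metric space. -/
theorem indBelow_of_closed_cover {Y : Type*} [MetricSpace Y] [SecondCountableTopology Y]
    {n : ℕ} {A : Set Y} (C : ℕ → Set Y) (hC : ∀ i, IsClosed (C i)) (hcov : A ⊆ ⋃ i, C i)
    (h : ∀ i, indBelow n ↥(A ∩ C i)) : indBelow n A :=
  indBelow_of_coveredByZeroDim
    (.of_closed_cover C hC hcov fun i => coveredByZeroDim_of_indBelow (h i))

end IndBelow

section Dimensions

variable {Y : Type*} [MetricSpace Y]

theorem neg_one_le_indDim (Z : Type*) [TopologicalSpace Z] : -1 ≤ indDim Z := by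
  refine le_sInf ?_
  rintro _ ⟨n, -, rfl⟩
  have h : (0 : EReal) ≤ n := Nat.cast_nonneg' n
  simpa using EReal.sub_le_sub h (le_refl (1 : EReal))

theorem indDim_le_of_indBelow {Z : Type*} [TopologicalSpace Z] {n : ℕ} (h : indBelow n Z) :
    indDim Z ≤ (n : EReal) - 1 :=
  sInf_le ⟨n, h, rfl⟩

theorem exists_indBelow_of_indDim_le {Z : Type*} [TopologicalSpace Z] {t : EReal}
    (h : indDim Z ≤ t) (ht : t ≠ ⊤) : ∃ n : ℕ, indBelow n Z ∧ (n : EReal) - 1 ≤ t := by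
  classical
  have hex : ∃ n : ℕ, indBelow n Z := by
    obtain ⟨_, ⟨n, hn, rfl⟩, -⟩ := sInf_lt_iff.1 (h.trans_lt (lt_top_iff_ne_top.2 ht))
    exact ⟨n, hn⟩
  refine ⟨Nat.find hex, Nat.find_spec hex, le_trans (le_sInf ?_) h⟩
  rintro _ ⟨n, hn, rfl⟩
  exact EReal.sub_le_sub (Nat.cast_le.2 (Nat.find_min' hex hn)) le_rfl

theorem EReal.natCast_sub_one (n : ℕ) : (n : EReal) - 1 = (((n : ℝ) - 1 : ℝ) : EReal) := rfl

theorem tdim_mono {A B : Set Y} (hAB : A ⊆ B) : tdim A ≤ tdim B := by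
  refine le_sInf ?_
  rintro _ ⟨n, hn, rfl⟩
  exact indDim_le_of_indBelow (indBelow_mono_set hAB hn)

theorem tdim_le_of_closed_cover [SecondCountableTopology Y] {A : Set Y} {t : EReal}
    (C : ℕ → Set Y) (hC : ∀ i, IsClosed (C i)) (hcov : A ⊆ ⋃ i, C i)
    (h : ∀ i, tdim (A ∩ C i) ≤ t) : tdim A ≤ t := by
  rcases eq_or_ne t ⊤ with rfl | htop
  · exact le_top
  have ht : -1 ≤ t := (neg_one_le_indDim _).trans (h 0)
  lift t to ℝ using ⟨htop, fun hb => by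
    rw [hb, le_bot_iff] at ht
    exact EReal.coe_ne_bot (-1) ht⟩
  have ht' : 0 ≤ t + 1 := by
    have : (-1 : ℝ) ≤ t := EReal.coe_le_coe_iff.1 ht
    linarith
  have hm : ∀ i, indBelow ⌊t + 1⌋₊ ↥(A ∩ C i) := fun i => by
    obtain ⟨n, hn, hnt⟩ := exists_indBelow_of_indDim_le (h i) (EReal.coe_ne_top t)
    rw [EReal.natCast_sub_one, EReal.coe_le_coe_iff] at hnt
    exact indBelow_mono_s6 (Nat.le_floor (by linarith)) hn
  refine (indDim_le_of_indBelow (indBelow_of_closed_cover C hC hcov hm)).trans ?_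
  rw [EReal.natCast_sub_one, EReal.coe_le_coe_iff]
  linarith [Nat.floor_le ht']

theorem hdim_mono_s6 {A B : Set Y} (hAB : A ⊆ B) : hdim A ≤ hdim B := by
  unfold hdim
  split_ifs with hA hB hB
  · exact le_rfl
  · exact (by norm_num : (-1 : EReal) ≤ 0).trans (EReal.coe_ennreal_nonneg _)
  · exact absurd (subset_empty_iff.1 (hB ▸ hAB)) hA
  · exact EReal.coe_ennreal_le_coe_ennreal_iff.2 (dimH_mono hAB)

theorem hdim_le_of_cover {A : Set Y} {t : EReal} (C : ℕ → Set Y) (hcov : A ⊆ ⋃ i, C i)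
    (h : ∀ i, hdim (A ∩ C i) ≤ t) : hdim A ≤ t := by
  rcases A.eq_empty_or_nonempty with rfl | hA
  · simpa using h 0
  have hU : A = ⋃ i, A ∩ C i := by rw [← inter_iUnion, inter_eq_left.2 hcov]
  have hd : ∀ i, (A ∩ C i).Nonempty → (dimH (A ∩ C i) : EReal) ≤ t := fun i hi => by
    have := h i
    rwa [hdim, if_neg hi.ne_empty] at this
  obtain ⟨x, hx⟩ := hA
  obtain ⟨k, hk⟩ := mem_iUnion.1 (hcov hx)
  have ht : 0 ≤ t := (EReal.coe_ennreal_nonneg _).trans (hd k ⟨x, hx, hk⟩)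
  rw [hdim, if_neg (nonempty_of_mem hx).ne_empty]
  have hd' : ∀ i, dimH (A ∩ C i) ≤ t.toENNReal := fun i => by
    rcases (A ∩ C i).eq_empty_or_nonempty with he | hi
    · simp [he]
    · exact EReal.coe_ennreal_le_coe_ennreal_iff.1 (by
        rw [EReal.coe_toENNReal ht]; exact hd i hi)
  rw [← EReal.coe_toENNReal ht, EReal.coe_ennreal_le_coe_ennreal_iff, hU, dimH_iUnion]
  exact iSup_le hd'

theorem packPre0_mono (h : ℝ≥0 → ℝ≥0) {A B : Set Y} (hAB : A ⊆ B) :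
    packPre0 h A ≤ packPre0 h B := by
  refine iInf₂_mono fun δ _ => iSup_le fun s => iSup_le fun hs => ?_
  exact le_iSup₂_of_le s ⟨hs.1, fun p hp => ⟨hAB (hs.2.1 p hp).1, (hs.2.1 p hp).2⟩, hs.2.2⟩ le_rfl

theorem packMeasure_le_tsum (h : ℝ≥0 → ℝ≥0) {A : Set Y} (c : ℕ → Set Y) (hc : A ⊆ ⋃ i, c i) :
    packMeasure h A ≤ ∑' i, packPre0 h (c i) := by
  refine (iInf₂_le (fun i => A ∩ c i) ?_).trans
    (ENNReal.tsum_le_tsum fun i => packPre0_mono h inter_subset_right)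
  rw [← inter_iUnion, inter_eq_left.2 hc]

theorem packMeasure_mono (h : ℝ≥0 → ℝ≥0) {A B : Set Y} (hAB : A ⊆ B) :
    packMeasure h A ≤ packMeasure h B := by
  refine le_iInf₂ fun c hc => packMeasure_le_tsum h c (hc ▸ hAB)

theorem packPre_rpow_le {s s' : ℝ≥0} (hss : s' < s) (A : Set Y) (δ : ℝ≥0) :
    packPre (fun r => r ^ (s : ℝ)) A δ ≤
      ((δ ^ ((s : ℝ) - s') : ℝ≥0) : ℝ≥0∞) * packPre (fun r => r ^ (s' : ℝ)) A δ := by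
  refine iSup₂_le fun σ hσ => ?_
  refine le_trans ?_ (mul_le_mul_right (le_iSup₂_of_le σ hσ le_rfl) _)
  rw [← ENNReal.tsum_mul_left]
  refine ENNReal.tsum_le_tsum fun p => ?_
  rw [← ENNReal.coe_mul, ENNReal.coe_le_coe]
  have hpos : (0 : ℝ) < (s : ℝ) - s' := sub_pos.2 (NNReal.coe_lt_coe.2 hss)
  calc p.1.2 ^ (s : ℝ) = p.1.2 ^ ((s : ℝ) - s') * p.1.2 ^ (s' : ℝ) := by
        rw [← NNReal.rpow_add_of_nonneg _ hpos.le s'.coe_nonneg, sub_add_cancel]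
    _ ≤ _ := by
        gcongr
        exact (hσ.2.1 _ p.2).2

theorem packPre_mono_radius (h : ℝ≥0 → ℝ≥0) (A : Set Y) {δ ε : ℝ≥0} (hδ : δ ≤ ε) :
    packPre h A δ ≤ packPre h A ε :=
  iSup₂_le fun σ hσ => le_iSup₂_of_le σ
    ⟨hσ.1, fun p hp => ⟨(hσ.2.1 p hp).1, (hσ.2.1 p hp).2.trans hδ⟩, hσ.2.2⟩ le_rfl

theorem packPre0_rpow_eq_zero {s s' : ℝ≥0} (hss : s' < s) {A : Set Y}
    (hA : packPre0 (fun r => r ^ (s' : ℝ)) A ≠ ∞) : packPre0 (fun r => r ^ (s : ℝ)) A = 0 := by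
  obtain ⟨ε, hε⟩ := iInf_lt_iff.1 (lt_top_iff_ne_top.2 hA)
  obtain ⟨hε0, hε⟩ := iInf_lt_iff.1 hε
  have hpos : (0 : ℝ) < (s : ℝ) - s' := sub_pos.2 (NNReal.coe_lt_coe.2 hss)
  have hlim : Tendsto (fun δ : ℝ≥0 => ((δ ^ ((s : ℝ) - s') : ℝ≥0) : ℝ≥0∞) *
      packPre (fun r => r ^ (s' : ℝ)) A ε) (𝓝[>] 0) (𝓝 0) := by
    have h1 : Tendsto (fun δ : ℝ≥0 => ((δ ^ ((s : ℝ) - s') : ℝ≥0) : ℝ≥0∞)) (𝓝[>] 0) (𝓝 0) := by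
      have h2 : Continuous fun δ : ℝ≥0 => δ ^ ((s : ℝ) - s') := NNReal.continuous_rpow_const hpos.le
      have h3 := (ENNReal.continuous_coe.comp h2).tendsto 0
      simp only [Function.comp_apply, NNReal.zero_rpow hpos.ne', ENNReal.coe_zero] at h3
      exact h3.mono_left nhdsWithin_le_nhds
    simpa using ENNReal.Tendsto.mul_const h1 (.inr hε.ne)
  refine le_antisymm (ge_of_tendsto hlim ?_) bot_le
  filter_upwards [Ioo_mem_nhdsGT hε0] with δ hδ
  calc packPre0 (fun r => r ^ (s : ℝ)) A ≤ packPre (fun r => r ^ (s : ℝ)) A δ :=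
        iInf₂_le δ hδ.1
    _ ≤ _ := packPre_rpow_le hss A δ
    _ ≤ _ := by gcongr; exact packPre_mono_radius _ A hδ.2.le

theorem packMeasure_rpow_iUnion_eq_zero {s s' : ℝ≥0} (hss : s' < s) {A : Set Y} (C : ℕ → Set Y)
    (hcov : A ⊆ ⋃ i, C i) (h : ∀ i, packMeasure (fun r => r ^ (s' : ℝ)) (A ∩ C i) ≠ ∞) :
    packMeasure (fun r => r ^ (s : ℝ)) A = 0 := by
  have hc : ∀ i, ∃ c : ℕ → Set Y, A ∩ C i = ⋃ j, c j ∧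
      ∀ j, packPre0 (fun r => r ^ (s' : ℝ)) (c j) ≠ ∞ := fun i => by
    obtain ⟨c, hc⟩ := iInf_lt_iff.1 (lt_top_iff_ne_top.2 (h i))
    obtain ⟨hc, hlt⟩ := iInf_lt_iff.1 hc
    exact ⟨c, hc, ENNReal.ne_top_of_tsum_ne_top hlt.ne⟩
  choose c hc hfin using hc
  refine le_antisymm ((packMeasure_le_tsum _ (fun k => c k.unpair.1 k.unpair.2) ?_).trans ?_) bot_le
  · intro x hx
    obtain ⟨i, hi⟩ := mem_iUnion.1 (hcov hx)
    have hxi : x ∈ A ∩ C i := ⟨hx, hi⟩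
    rw [hc] at hxi
    obtain ⟨j, hj⟩ := mem_iUnion.1 hxi
    exact mem_iUnion.2 ⟨Nat.pair i j, by simpa using hj⟩
  · simp [packPre0_rpow_eq_zero hss (hfin _ _)]

theorem pdim_mono {A B : Set Y} (hAB : A ⊆ B) : pdim A ≤ pdim B := by
  unfold pdim
  split_ifs with hA hB hB
  · exact le_rfl
  · exact (by norm_num : (-1 : EReal) ≤ 0).trans (le_max_left _ _)
  · exact absurd (subset_empty_iff.1 (hB ▸ hAB)) hA
  · refine max_le_max_left _ (iSup₂_le fun s hs => le_iSup₂_of_le s ?_ le_rfl)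
    exact top_le_iff.1 (hs ▸ packMeasure_mono _ hAB)

theorem pdim_le_of_cover {A : Set Y} {t : EReal} (C : ℕ → Set Y) (hcov : A ⊆ ⋃ i, C i)
    (h : ∀ i, pdim (A ∩ C i) ≤ t) : pdim A ≤ t := by
  rcases A.eq_empty_or_nonempty with rfl | hA
  · simpa using h 0
  obtain ⟨x, hx⟩ := hA
  obtain ⟨k, hk⟩ := mem_iUnion.1 (hcov hx)
  have ht : 0 ≤ t := by
    refine le_trans ?_ (h k)
    rw [pdim, if_neg (nonempty_of_mem (mem_inter hx hk)).ne_empty]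
    exact le_max_left _ _
  rw [pdim, if_neg (nonempty_of_mem hx).ne_empty]
  refine max_le ht (iSup₂_le fun s hs => ?_)
  by_contra! hlt
  obtain ⟨r, htr, hrs⟩ := EReal.lt_iff_exists_real_btwn.1 hlt
  have hr : 0 ≤ r := EReal.coe_nonneg.1 (ht.trans htr.le)
  lift r to ℝ≥0 using hr
  have hss : r < s := by exact_mod_cast hrs
  have hz := packMeasure_rpow_iUnion_eq_zero hss C hcov fun i hi => ?_
  · rw [hz] at hs
    exact ENNReal.zero_ne_top hs
  · have hne : A ∩ C i ≠ ∅ := by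
      intro he
      have h0 : packMeasure (fun u => u ^ (r : ℝ)) (∅ : Set Y) ≤ 0 := by
        refine (packMeasure_le_tsum _ (fun _ => ∅) (empty_subset _)).trans ?_
        have : packPre0 (fun u => u ^ (r : ℝ)) (∅ : Set Y) = 0 := by
          refine le_antisymm ((iInf₂_le 1 one_pos).trans (iSup₂_le fun σ hσ => ?_)) bot_le
          have : IsEmpty σ := ⟨fun p => (hσ.2.1 _ p.2).1⟩
          simp
        simp [this]
      rw [he] at hi
      simp [hi] at h0
    have hle := h i
    rw [pdim, if_neg hne] at hle
    exact absurd ((le_iSup₂_of_le (f := fun (s : ℝ≥0)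
      (_ : packMeasure (fun r => r ^ (s : ℝ)) (A ∩ C i) = ∞) => ((s : ℝ) : EReal)) r hi
      le_rfl).trans ((le_max_right _ _).trans hle)) htr.not_ge

end Dimensions

theorem IsFSigmaIn.exists_isClosed {Y : Type*} [MetricSpace Y] {F A : Set Y}
    (hF : IsFSigmaIn F A) (hA : IsFSigmaIn A univ) :
    ∃ E : ℕ → Set Y, (∀ i, IsClosed (E i)) ∧ F = ⋃ i, E i := by
  obtain ⟨C, hC, rfl⟩ := hF
  obtain ⟨D, hD, rfl⟩ := hA
  refine ⟨fun k => C k.unpair.1 ∩ D k.unpair.2, fun k => (hC _).inter (hD _), ?_⟩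
  rw [iUnion_unpair fun i j => C i ∩ D j]
  simp only [inter_univ, inter_iUnion]

theorem dStar_eq_iSup_of_closed_cover {Y : Type*} [MetricSpace Y] [SecondCountableTopology Y]
    (dim : Set Y → EReal) (hmono : ∀ {A B : Set Y}, A ⊆ B → dim A ≤ dim B)
    (hsum : ∀ {A : Set Y} {t : EReal} (C : ℕ → Set Y), (∀ i, IsClosed (C i)) → A ⊆ ⋃ i, C i →
      (∀ i, dim (A ∩ C i) ≤ t) → dim A ≤ t)
    (n : ℕ) (A : ℕ → Set Y) (hA : ∀ i, IsFSigmaIn (A i) univ) (hcover : ⋃ i, A i = univ) :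
    dStar dim n univ = ⨆ i, dStar dim n (A i) := by
  refine le_antisymm (le_of_forall_gt_imp_ge_of_dense fun t ht => ?_)
    (iSup_le fun i => le_sInf ?_)
  · have hF : ∀ i, ∃ F, IsFSigmaIn F (A i) ∧ tdim F ≤ (n : EReal) - 1 ∧ dim (A i \ F) < t :=
      fun i => by
        obtain ⟨_, ⟨F, hF, hFn, rfl⟩, hlt⟩ :=
          sInf_lt_iff.1 ((le_iSup (fun i => dStar dim n (A i)) i).trans_lt ht)
        exact ⟨F, hF, hFn, hlt⟩
    choose F hF hFn hFt using hF
    choose E hE hFE using fun i => (hF i).exists_isClosed (hA i)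
    choose D hD hAD using hA
    have hEF : ∀ k : ℕ, E k.unpair.1 k.unpair.2 ⊆ F k.unpair.1 := fun k => by
      rw [hFE k.unpair.1]; exact subset_iUnion (E k.unpair.1) _
    have hDA : ∀ k : ℕ, D k.unpair.1 k.unpair.2 ⊆ A k.unpair.1 := fun k => by
      rw [hAD k.unpair.1]; simpa using subset_iUnion (D k.unpair.1) _
    have hFun : ⋃ i, F i = ⋃ k : ℕ, E k.unpair.1 k.unpair.2 := by
      rw [iUnion_unpair E]; exact iUnion_congr hFE
    have hDun : ⋃ k : ℕ, D k.unpair.1 k.unpair.2 = univ := by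
      rw [iUnion_unpair D, ← hcover]
      exact iUnion_congr fun i => by simp [hAD i]
    have hle : dStar dim n univ ≤ dim (univ \ ⋃ i, F i) := by
      refine sInf_le ⟨_, ⟨fun k => E k.unpair.1 k.unpair.2, fun k => hE _ _, ?_⟩, ?_, rfl⟩
      · simpa using hFun
      · exact tdim_le_of_closed_cover _ (fun k => hE _ _) hFun.le fun k =>
          (tdim_mono (inter_subset_right.trans (hEF k))).trans (hFn _)
    refine hle.trans (hsum (fun k => D k.unpair.1 k.unpair.2) (fun k => hD _ _)
      ((subset_univ _).trans hDun.ge) fun k => (hmono ?_).trans (hFt k.unpair.1).le)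
    exact fun x hx => ⟨hDA k hx.2, fun hxF => hx.1.2 (mem_iUnion.2 ⟨_, hxF⟩)⟩
  · rintro _ ⟨F, ⟨C, hC, rfl⟩, hFn, rfl⟩
    have hle : dStar dim n (A i) ≤ dim (A i \ (A i ∩ ⋃ j, C j ∩ univ)) := by
      refine sInf_le ⟨_, ⟨C, hC, ?_⟩, ?_, rfl⟩
      · simp only [inter_univ, inter_iUnion, inter_comm]
      · exact (tdim_mono inter_subset_right).trans hFn
    refine hle.trans (hmono fun x hx => ?_)
    exact ⟨mem_univ _, fun h => hx.2 ⟨hx.1, h⟩⟩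

/-- `d^n_*` is countably stable for `F_σ` sets. -/
theorem stmt6 (X : Type*) [MetricSpace X] [TopologicalSpace.SeparableSpace X]
    (n : ℕ) (hn : 0 < n)
    (dimStar : Set X → EReal)
    (hdimStar : dimStar = tdim ∨ dimStar = hdim ∨ dimStar = pdim)
    (A : ℕ → Set X) (hA : ∀ i, IsFSigmaIn (A i) Set.univ)
    (hcover : (⋃ i, A i) = Set.univ) :
    dStar dimStar n (Set.univ : Set X) = ⨆ i, dStar dimStar n (A i) := by
  have := UniformSpace.secondCountable_of_separable X
  rcases hdimStar with rfl | rfl | rfl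
  · exact dStar_eq_iSup_of_closed_cover tdim tdim_mono tdim_le_of_closed_cover n A hA hcover
  · exact dStar_eq_iSup_of_closed_cover hdim hdim_mono_s6
      (fun C _ hcov h => hdim_le_of_cover C hcov h) n A hA hcover
  · exact dStar_eq_iSup_of_closed_cover pdim pdim_mono
      (fun C _ hcov h => pdim_le_of_cover C hcov h) n A hA hcover
end
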